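/- For every finite simple graph H with chromatic number χ(H) ≥ 3 and every positive real δ, there exists a positive constant C such that the following holds: for every positive real η there exists n₀ such that for all n ≥ n₀ and all m with C·n^{2 − 1/m₂(H)} ≤ m ≤ binom(n,2), the number of H-free graphs on the vertex set {1,…,n} with exactly m edges that are NOT (δ, χ(H)−1)-partite is at most η times the total number of H-free graphs on {1,…,n} with exactly m edges. -/

import Mathlib

attribute [local instance] Classical.propDecidable

/-- `G` contains a copy of `H` (as a subgraph). -/
def GraphCopy {α β : Type*} (H : SimpleGraph α) (G : SimpleGraph β) : Prop :=
  ∃ f : α → β, Function.Injective f ∧ ∀ a b : α, H.Adj a b → G.Adj (f a) (f b)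

/-- The `2`-density `m₂(H)` of a graph `H`: the maximum of `(e(H') - 1)/(v(H') - 2)` over
all subgraphs `H' ⊆ H` with at least `3` vertices. -/
noncomputable def m2 {α : Type*} [Fintype α] (H : SimpleGraph α) : ℝ :=
  sSup {x : ℝ | ∃ s : Finset α, 3 ≤ s.card ∧
    x = ((Nat.card {e : Sym2 α // e ∈ H.edgeSet ∧ ∀ v ∈ e, v ∈ s} : ℝ) - 1) /
      ((s.card : ℝ) - 2)}

/-- The edge set of a graph with `m` edges on `{1, …, n}`, represented as an `m`-element set
of non-diagonal elements of `Sym2 (Fin n)`; the graph `E` is `(δ, k)`-partite if one can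
delete at most `δ·m` of its edges to obtain a `k`-colorable graph. -/
def DeltaKPartite (n : ℕ) (δ : ℝ) (k : ℕ) (E : Finset (Sym2 (Fin n))) : Prop :=
  ∃ R ⊆ E, (R.card : ℝ) ≤ δ * (E.card : ℝ) ∧
    (SimpleGraph.fromEdgeSet ((E \ R : Finset (Sym2 (Fin n))) : Set (Sym2 (Fin n)))).Colorable k

/-- A selection scheme: `sel I ⊆ I` is a fingerprint of `I`, and the fingerprint determines
the output. -/
structure Scheme (V : Type) (σ : Type) where
  sel : Finset V → Finset V
  out : Finset V → σ
  sub : ∀ I, sel I ⊆ I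
  cons : ∀ I J, sel I ⊆ J → J ⊆ I → sel J = sel I ∧ out J = out I

namespace Scheme

variable {V σ ρ : Type}

def const (x : σ) : Scheme V σ := ⟨fun _ => ∅, fun _ => x, by simp, by simp⟩

noncomputable def bind (a : Scheme V σ) (b : σ → Scheme V ρ) : Scheme V ρ where
  sel I := a.sel I ∪ (b (a.out I)).sel I
  out I := (b (a.out I)).out I
  sub I := Finset.union_subset (a.sub I) ((b _).sub I)
  cons I J h1 h2 := by
    have h := a.cons I J (Finset.subset_union_left.trans h1) h2
    rw [h.2]
    have h' := (b (a.out I)).cons I J (Finset.subset_union_right.trans h1) h2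
    simp [h.1, h'.1, h'.2]

noncomputable def query (v : V) (a b : Scheme V σ) : Scheme V σ where
  sel I := if v ∈ I then insert v (a.sel I) else b.sel I
  out I := if v ∈ I then a.out I else b.out I
  sub I := by
    by_cases h : v ∈ I
    · simp only [h, if_true]
      exact Finset.insert_subset h (a.sub I)
    · simp only [h, if_false]
      exact b.sub I
  cons I J h1 h2 := by
    by_cases h : v ∈ I
    · simp only [h, if_true] at h1 ⊢
      have hJ : v ∈ J := h1 (Finset.mem_insert_self _ _)
      have := a.cons I J ((Finset.subset_insert _ _).trans h1) h2
      simp [hJ, this.1, this.2]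
    · simp only [h, if_false] at h1 ⊢
      have hJ : v ∉ J := fun hh => h (h2 hh)
      have := b.cons I J h1 h2
      simp [hJ, this.1, this.2]

theorem bind_sel (a : Scheme V σ) (b : σ → Scheme V ρ) (I : Finset V) :
    (a.bind b).sel I = a.sel I ∪ (b (a.out I)).sel I := rfl

theorem bind_out (a : Scheme V σ) (b : σ → Scheme V ρ) (I : Finset V) :
    (a.bind b).out I = (b (a.out I)).out I := rfl

theorem const_sel (x : σ) (I : Finset V) : (const x : Scheme V σ).sel I = ∅ := rfl

theorem const_out (x : σ) (I : Finset V) : (const x : Scheme V σ).out I = x := rfl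

end Scheme

theorem treeRun {V σ : Type} (Inv : σ → Finset V → Prop) (Fi : σ → Prop) (μ : σ → ℕ)
    (Y : σ → Finset V)
    (step : ∀ s, ¬ Fi s → ∃ v s1 s0, μ s1 < μ s ∧ μ s0 < μ s ∧ Y s ⊆ Y s1 ∧ v ∈ Y s1 ∧
      Y s ⊆ Y s0 ∧
      ∀ I, Inv s I → (v ∈ I → Inv s1 I) ∧ (v ∉ I → Inv s0 I)) :
    ∀ (n : ℕ) (s : σ), μ s ≤ n → ∃ S : Scheme V σ, ∀ I, Inv s I →
      Inv (S.out I) I ∧ Fi (S.out I) ∧ S.sel I ⊆ Y (S.out I) ∧ Y s ⊆ Y (S.out I) := by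
  intro n
  induction n with
  | zero =>
    intro s hs
    by_cases hF : Fi s
    · exact ⟨Scheme.const s, fun I hI => by simp [Scheme.const, hF, hI]⟩
    · obtain ⟨v, s1, s0, h1, -⟩ := step s hF
      omega
  | succ n ih =>
    intro s hs
    by_cases hF : Fi s
    · exact ⟨Scheme.const s, fun I hI => by simp [Scheme.const, hF, hI]⟩
    · obtain ⟨v, s1, s0, h1, h0, hY1, hv, hY0, H⟩ := step s hF
      obtain ⟨S1, H1⟩ := ih s1 (by omega)
      obtain ⟨S0, H0⟩ := ih s0 (by omega)
      refine ⟨Scheme.query v S1 S0, fun I hI => ?_⟩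
      by_cases hvI : v ∈ I
      · obtain ⟨a, b, c, d⟩ := H1 I ((H I hI).1 hvI)
        simp only [Scheme.query, hvI, if_true]
        exact ⟨a, b, Finset.insert_subset (d hv) c, hY1.trans d⟩
      · obtain ⟨a, b, c, d⟩ := H0 I ((H I hI).2 hvI)
        simp only [Scheme.query, hvI, if_false]
        exact ⟨a, b, c, hY0.trans d⟩

/-- Degree of a set `S` in the multi-hypergraph `(f i)_{i ∈ E}`. -/
noncomputable def hdeg {V ι : Type} (E : Finset ι) (f : ι → Finset V) (S : Finset V) : ℕ :=
  (E.filter fun i => S ⊆ f i).card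

structure CState (V ι : Type) where
  X : Finset V
  Y : Finset V
  B : Finset ι
  g : ι → Finset V

section process
variable {V ι : Type} [Fintype V] (E : Finset ι) (f : ι → Finset V) (τ Δ : ℕ → ℝ) (D : ℝ)
  (L k : ℕ)

noncomputable def CState.A (s : CState V ι) : Finset ι :=
  E.filter fun i => Disjoint (f i) s.Y ∧
    ∀ S ⊆ f i, S.Nonempty → (hdeg s.B s.g S : ℝ) < τ S.card

def CState.Fi (s : CState V ι) : Prop :=
  L ≤ s.Y.card ∨ ∀ v, v ∉ s.X → (hdeg (s.A E f τ) f {v} : ℝ) < D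

structure CState.Inv (s : CState V ι) (I : Finset V) : Prop where
  hX : Disjoint s.X I
  hY : s.Y ⊆ I
  hL : s.Y.card ≤ L
  hXE : s.X ⊆ E.biUnion f
  hB : ∀ i ∈ s.B, i ∈ E ∧ ¬ Disjoint (f i) s.Y ∧ s.g i ⊆ f i ∧ (s.g i).card = k ∧
    f i ⊆ s.g i ∪ s.Y
  hdeg : ∀ S : Finset V, S.Nonempty → (hdeg s.B s.g S : ℝ) ≤ τ S.card + Δ (S.card + 1)
  hD : D * s.Y.card ≤ s.B.card

theorem process (hD : 0 < D) (hτ : ∀ n, 0 ≤ τ n) (hΔ0 : ∀ n, 0 ≤ Δ n)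
    (hf : ∀ i ∈ E, (f i).card = k + 1)
    (hΔ : ∀ S : Finset V, S.Nonempty → (hdeg E f S : ℝ) ≤ Δ S.card) :
    ∃ S : Scheme V (CState V ι), ∀ I, 
      CState.Inv E f τ Δ D L k (S.out I) I ∧ CState.Fi E f τ D L (S.out I) ∧
        S.sel I ⊆ (S.out I).Y := by
  have hstep : ∀ s, ¬ CState.Fi E f τ D L s → ∃ v s1 s0,
      (fun s : CState V ι => (s.X ∪ s.Y)ᶜ.card) s1 < (fun s : CState V ι => (s.X ∪ s.Y)ᶜ.card) s ∧
      (fun s : CState V ι => (s.X ∪ s.Y)ᶜ.card) s0 < (fun s : CState V ι => (s.X ∪ s.Y)ᶜ.card) s ∧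
      s.Y ⊆ s1.Y ∧ v ∈ s1.Y ∧ s.Y ⊆ s0.Y ∧
      ∀ I, CState.Inv E f τ Δ D L k s I → (v ∈ I → CState.Inv E f τ Δ D L k s1 I) ∧
        (v ∉ I → CState.Inv E f τ Δ D L k s0 I) := by
    intro s hs
    simp only [CState.Fi, not_or, not_le, not_forall, not_lt] at hs
    obtain ⟨hL, v, hvX, hv⟩ := hs
    have hvY : v ∉ s.Y := by
      intro hvY
      have : hdeg (s.A E f τ) f {v} = 0 := by
        unfold hdeg
        rw [Finset.card_eq_zero, Finset.filter_eq_empty_iff]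
        intro i hi hvi
        simp only [CState.A, Finset.mem_filter] at hi
        exact Finset.disjoint_left.1 hi.2.1 (hvi (Finset.mem_singleton_self v)) hvY
      rw [this] at hv
      simp at hv
      linarith
    set N := (s.A E f τ).filter (fun i => v ∈ f i) with hN
    have hNcard : (hdeg (s.A E f τ) f {v}) = N.card := by
      simp [hdeg, hN]
    have hNE : ∀ i ∈ N, i ∈ E ∧ v ∈ f i ∧ Disjoint (f i) s.Y ∧
        ∀ S ⊆ f i, S.Nonempty → (hdeg s.B s.g S : ℝ) < τ S.card := by
      intro i hi
      simp only [hN, CState.A, Finset.mem_filter] at hi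
      exact ⟨hi.1.1, hi.2, hi.1.2.1, hi.1.2.2⟩
    have hN0 : N.Nonempty := by
      rw [← Finset.card_pos, ← hNcard]
      have : (0 : ℝ) < (hdeg (s.A E f τ) f {v} : ℝ) := by linarith
      exact_mod_cast this
    have hmeas : ∀ W : Finset V, s.X ∪ s.Y ⊆ W → v ∈ W → Wᶜ.card < (s.X ∪ s.Y)ᶜ.card := by
      intro W hW hvW
      apply Finset.card_lt_card
      rw [Finset.compl_ssubset_compl]
      refine ⟨hW, fun h => ?_⟩
      have := h hvW
      simp [hvX, hvY] at this
    refine ⟨v, ⟨s.X, insert v s.Y, s.B ∪ N, fun i => if i ∈ N then (f i).erase v else s.g i⟩,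
      ⟨insert v s.X, s.Y, s.B, s.g⟩, ?_, ?_, Finset.subset_insert _ _,
      Finset.mem_insert_self _ _, le_rfl, ?_⟩
    · apply hmeas
      · exact Finset.union_subset_union le_rfl (Finset.subset_insert _ _)
      · simp
    · apply hmeas
      · exact Finset.union_subset_union (Finset.subset_insert _ _) le_rfl
      · simp
    · intro I hI
      have hBN : Disjoint s.B N := by
        rw [Finset.disjoint_left]
        intro i hiB hiN
        exact (hI.hB i hiB).2.1 (hNE i hiN).2.2.1
      refine ⟨fun hvI => ?_, fun hvI => ?_⟩
      · refine ⟨hI.hX, Finset.insert_subset hvI hI.hY, ?_, hI.hXE, ?_, ?_, ?_⟩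
        · have := Finset.card_insert_le v s.Y
          simp only; omega
        · intro i hi
          by_cases hiN : i ∈ N
          · obtain ⟨h1, h2, h3, h4⟩ := hNE i hiN
            simp only [hiN, if_true]
            refine ⟨h1, ?_, Finset.erase_subset _ _, ?_, ?_⟩
            · rw [Finset.not_disjoint_iff]
              exact ⟨v, h2, Finset.mem_insert_self _ _⟩
            · rw [Finset.card_erase_of_mem h2, hf i h1]; rfl
            · intro x hx
              by_cases hxv : x = v
              · simp [hxv]
              · simp [hxv, hx]
          · have hiB : i ∈ s.B := by
              rcases Finset.mem_union.1 hi with h | h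
              · exact h
              · exact absurd h hiN
            obtain ⟨h1, h2, h3, h4, h5⟩ := hI.hB i hiB
            simp only [hiN, if_false]
            refine ⟨h1, ?_, h3, h4, ?_⟩
            · intro hd
              exact h2 (hd.mono_right (Finset.subset_insert _ _))
            · exact h5.trans (Finset.union_subset_union le_rfl (Finset.subset_insert _ _))
        · intro S hS
          have hsplit : hdeg (s.B ∪ N) (fun i => if i ∈ N then (f i).erase v else s.g i) S
              = hdeg s.B s.g S + (N.filter fun i => S ⊆ (f i).erase v).card := by
            unfold hdeg
            rw [Finset.filter_union, Finset.card_union_of_disjoint]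
            · congr 1
              · congr 1
                apply Finset.filter_congr
                intro i hi
                have : i ∉ N := fun h => Finset.disjoint_left.1 hBN hi h
                simp [this]
              · congr 1
                apply Finset.filter_congr
                intro i hi
                simp [hi]
            · exact Finset.disjoint_filter_filter hBN
          simp only [hsplit]
          push_cast
          rcases Finset.eq_empty_or_nonempty (N.filter fun i => S ⊆ (f i).erase v) with h0 | h0
          · rw [h0]
            simpa using hI.hdeg S hS
          · obtain ⟨i, hi⟩ := h0
            rw [Finset.mem_filter] at hi
            have h1 := (hNE i hi.1).2.2.2 S (hi.2.trans (Finset.erase_subset _ _)) hS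
            have hvS : v ∉ S := fun h => by simpa using hi.2 h
            have h2 := hΔ (insert v S) (Finset.insert_nonempty _ _)
            rw [Finset.card_insert_of_notMem hvS] at h2
            have h3 : (N.filter fun i => S ⊆ (f i).erase v).card ≤ hdeg E f (insert v S) := by
              apply Finset.card_le_card
              intro j hj
              rw [Finset.mem_filter] at hj ⊢
              refine ⟨(hNE j hj.1).1, ?_⟩
              exact Finset.insert_subset (hNE j hj.1).2.1 (hj.2.trans (Finset.erase_subset _ _))
            have h3' : ((N.filter fun i => S ⊆ (f i).erase v).card : ℝ) ≤ hdeg E f (insert v S) := by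
              exact_mod_cast h3
            linarith
        · simp only
          rw [Finset.card_insert_of_notMem hvY, Finset.card_union_of_disjoint hBN]
          have := hI.hD
          rw [hNcard] at hv
          push_cast
          linarith
      · refine ⟨?_, hI.hY, hI.hL, ?_, hI.hB, hI.hdeg, hI.hD⟩
        · simp only
          rw [Finset.disjoint_insert_left]
          exact ⟨hvI, hI.hX⟩
        · simp only
          apply Finset.insert_subset _ hI.hXE
          obtain ⟨i, hi⟩ := hN0
          exact Finset.mem_biUnion.2 ⟨i, (hNE i hi).1, (hNE i hi).2.1⟩
  obtain ⟨S, hS⟩ := treeRun (CState.Inv E f τ Δ D L k) (CState.Fi E f τ D L)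
    (fun s => (s.X ∪ s.Y)ᶜ.card) (fun s => s.Y) hstep _ (⟨∅, ∅, ∅, fun _ => ∅⟩ : CState V ι) le_rfl
  refine ⟨S, fun I => ?_⟩
  have hinit : CState.Inv E f τ Δ D L k (⟨∅, ∅, ∅, fun _ => ∅⟩ : CState V ι) I := by
    refine ⟨by simp, by simp, by simp, by simp, by simp, ?_, by simp⟩
    intro S _
    have := hτ S.card
    have := hΔ0 (S.card + 1)
    simp only [_root_.hdeg, Finset.filter_empty, Finset.card_empty, Nat.cast_zero]
    linarith
  obtain ⟨a, b, c, -⟩ := hS I hinit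
  exact ⟨a, b, c⟩

end process

theorem card_hit_le {V ι : Type} [Fintype V] (E : Finset ι) (f : ι → Finset V) (Y : Finset V)
    (d : ℝ) (hd : ∀ v, (hdeg E f {v} : ℝ) ≤ d) :
    ((E.filter fun i => ¬ Disjoint (f i) Y).card : ℝ) ≤ Y.card * d := by
  have h1 : (E.filter fun i => ¬ Disjoint (f i) Y) ⊆
      Y.biUnion (fun v => E.filter fun i => ({v} : Finset V) ⊆ f i) := by
    intro i hi
    rw [Finset.mem_filter, Finset.not_disjoint_iff] at hi
    obtain ⟨hiE, v, hv, hvY⟩ := hi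
    simp only [Finset.mem_biUnion, Finset.mem_filter, Finset.singleton_subset_iff]
    exact ⟨v, hvY, hiE, hv⟩
  have h2 := (Finset.card_le_card h1).trans Finset.card_biUnion_le
  calc ((E.filter fun i => ¬ Disjoint (f i) Y).card : ℝ)
      ≤ ((∑ v ∈ Y, (E.filter fun i => ({v} : Finset V) ⊆ f i).card : ℕ) : ℝ) := by
        exact_mod_cast h2
    _ ≤ ∑ v ∈ Y, d := by
        push_cast
        exact Finset.sum_le_sum fun v _ => hd v
    _ = _ := by simp

theorem sum_hdeg {V ι : Type} [Fintype V] (B : Finset ι) (g : ι → Finset V) (k : ℕ)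
    (hg : ∀ i ∈ B, (g i).card = k) :
    ∑ S : Finset V, hdeg B g S = B.card * 2 ^ k := by
  unfold hdeg
  simp_rw [Finset.card_filter]
  rw [Finset.sum_comm, Finset.card_eq_sum_ones, Finset.sum_mul]
  apply Finset.sum_congr rfl
  intro i hi
  rw [← Finset.card_filter, one_mul, ← hg i hi, ← Finset.card_powerset]
  congr 1
  ext S
  simp

theorem sum_hdeg_single {V ι : Type} [Fintype V] (A : Finset ι) (f : ι → Finset V) (k : ℕ)
    (hg : ∀ i ∈ A, (f i).card = k) :
    ∑ v : V, hdeg A f {v} = A.card * k := by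
  unfold hdeg
  simp_rw [Finset.card_filter]
  rw [Finset.sum_comm, Finset.card_eq_sum_ones, Finset.sum_mul]
  apply Finset.sum_congr rfl
  intro i hi
  rw [← Finset.card_filter, one_mul, ← hg i hi]
  congr 1
  ext S
  simp

theorem card_sat_le {V ι : Type} [Fintype V] (E B : Finset ι) (f g : ι → Finset V) (k : ℕ)
    (hg : ∀ i ∈ B, (g i).card = k) (τ Δ : ℕ → ℝ) (R : ℝ) (hR : 0 ≤ R)
    (hΔ : ∀ S : Finset V, S.Nonempty → (hdeg E f S : ℝ) ≤ Δ S.card)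
    (hΔτ : ∀ s, 1 ≤ s → Δ s ≤ R * τ s) :
    ((E.filter fun i => ∃ S ⊆ f i, S.Nonempty ∧ τ S.card ≤ hdeg B g S).card : ℝ) ≤
      R * (B.card * 2 ^ k) := by
  have h1 : (E.filter fun i => ∃ S ⊆ f i, S.Nonempty ∧ τ S.card ≤ hdeg B g S) ⊆
      (Finset.univ.filter fun S : Finset V => S.Nonempty ∧ τ S.card ≤ hdeg B g S).biUnion
        (fun S => E.filter fun i => S ⊆ f i) := by
    intro i hi
    simp only [Finset.mem_filter] at hi
    obtain ⟨hiE, S, hS, h⟩ := hi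
    simp only [Finset.mem_biUnion, Finset.mem_filter, Finset.mem_univ, true_and]
    exact ⟨S, h, hiE, hS⟩
  have h2 := (Finset.card_le_card h1).trans Finset.card_biUnion_le
  calc _ ≤ ((∑ S ∈ Finset.univ.filter fun S : Finset V => S.Nonempty ∧ τ S.card ≤ hdeg B g S,
          (E.filter fun i => S ⊆ f i).card : ℕ) : ℝ) := by exact_mod_cast h2
    _ ≤ ∑ S ∈ Finset.univ.filter fun S : Finset V => S.Nonempty ∧ τ S.card ≤ hdeg B g S,
          R * (hdeg B g S : ℝ) := by
        push_cast
        apply Finset.sum_le_sum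
        intro S hS
        simp only [Finset.mem_filter, Finset.mem_univ, true_and] at hS
        exact (hΔ S hS.1).trans ((hΔτ _ hS.1.card_pos).trans
          (mul_le_mul_of_nonneg_left hS.2 hR))
    _ ≤ ∑ S : Finset V, R * (hdeg B g S : ℝ) := by
        apply Finset.sum_le_sum_of_subset_of_nonneg (Finset.filter_subset _ _)
        intros; positivity
    _ = R * (B.card * 2 ^ k) := by
        rw [← Finset.mul_sum]
        congr 1
        exact_mod_cast sum_hdeg B g k hg

/-- Hypotheses of the container lemma. -/
structure HUnif {V ι : Type} [Fintype V] (k : ℕ) (K p : ℝ) (E : Finset ι)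
    (f : ι → Finset V) : Prop where
  ne : E.Nonempty
  unif : ∀ i ∈ E, (f i).card = k
  deg : ∀ S : Finset V, S.Nonempty →
    (hdeg E f S : ℝ) ≤ K * p ^ (S.card - 1) * E.card / Fintype.card V

theorem one_step (k : ℕ) : ∀ K : ℝ, 1 ≤ K → ∃ c M p0 : ℝ, 0 < c ∧ 0 < M ∧ 0 < p0 ∧
    ∀ (V ι : Type) [Fintype V] (E : Finset ι) (f : ι → Finset V) (p : ℝ), 0 < p → p ≤ p0 →
      1 ≤ p * Fintype.card V → HUnif k K p E f →
      ∃ s : Scheme V (Finset V), ∀ I, (∀ i ∈ E, ¬ f i ⊆ I) →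
        ((s.sel I).card : ℝ) ≤ M * (p * Fintype.card V) ∧ Disjoint (s.out I) I ∧
        s.out I ⊆ E.biUnion f ∧ c * Fintype.card V ≤ ((s.out I).card : ℝ) := by
  induction k with
  | zero =>
    intro K hK
    refine ⟨1, 1, 1, one_pos, one_pos, one_pos, ?_⟩
    intro V ι _ E f p hp hp0 hpN hE
    refine ⟨Scheme.const ∅, fun I hI => ?_⟩
    obtain ⟨i, hi⟩ := hE.ne
    have := hE.unif i hi
    rw [Finset.card_eq_zero] at this
    exact absurd (by rw [this]; simp) (hI i hi)
  | succ k ih =>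
    intro K hK
    set K' : ℝ := 2 ^ (k + 3) * K ^ 2 with hK'
    have hK'1 : 0 < K' := by positivity
    obtain ⟨c, M, p0, hc, hM, hp0, IH⟩ := ih (4 * (K' + K)) (by linarith)
    refine ⟨min c (1 / (4 * K)), 2 + M, min p0 (1 / (8 * K)), by positivity, by positivity,
      by positivity, ?_⟩
    intro V ι _ E f p hp hpp hpN hE
    have hpp0 : p ≤ p0 := hpp.trans (min_le_left _ _)
    have hpK : p * (8 * K) ≤ 1 := by
      have := hpp.trans (min_le_right _ _)
      rwa [le_div_iff₀ (by positivity)] at this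
    set N : ℝ := (Fintype.card V : ℝ) with hN
    have hN0 : 0 < N := by
      by_contra h
      have : N ≤ 0 := not_lt.1 h
      nlinarith
    set e : ℝ := (E.card : ℝ) with he
    have he0 : 0 < e := by
      exact Nat.cast_pos.2 hE.ne.card_pos
    set Δ : ℕ → ℝ := fun s => K * p ^ (s - 1) * e / N with hΔ
    set τ : ℕ → ℝ := fun s => K' * p ^ s * e / N with hτ
    set D : ℝ := e / (4 * N) with hD
    set L : ℕ := ⌈p * N⌉₊ with hL
    have hLle : (L : ℝ) ≤ 2 * (p * N) := by
      have := (Nat.ceil_lt_add_one (by positivity : 0 ≤ p * N)).le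
      linarith
    have hLge : p * N ≤ L := Nat.le_ceil _
    have hdeg1 : ∀ v : V, (hdeg E f {v} : ℝ) ≤ K * e / N := by
      intro v
      simpa using hE.deg {v} (Finset.singleton_nonempty v)
    obtain ⟨S, hS⟩ := process E f τ Δ D L k (by positivity) (fun n => by positivity)
      (fun n => by positivity) hE.unif hE.deg
    have hcond : ∀ s : CState V ι, ∃ S' : Scheme V (Finset V),
        (HUnif k (4 * (K' + K)) p s.B s.g → ∀ I, (∀ i ∈ s.B, ¬ s.g i ⊆ I) →
        ((S'.sel I).card : ℝ) ≤ M * (p * N) ∧ Disjoint (S'.out I) I ∧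
        S'.out I ⊆ s.B.biUnion s.g ∧ c * N ≤ ((S'.out I).card : ℝ)) := by
      intro s
      by_cases h : HUnif k (4 * (K' + K)) p s.B s.g
      · obtain ⟨S', hS'⟩ := IH V ι s.B s.g p hp hpp0 hpN h
        exact ⟨S', fun _ => hS'⟩
      · exact ⟨Scheme.const ∅, fun h' => absurd h' h⟩
    choose S' hS' using hcond
    refine ⟨S.bind fun s => if L ≤ s.Y.card then S' s else Scheme.const s.X, fun I hI => ?_⟩
    obtain ⟨hInv, hFi, hsel⟩ := hS I
    simp only [Scheme.bind_sel, Scheme.bind_out]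
    generalize S.out I = s at hInv hFi hsel ⊢
    have hYc : ((S.sel I).card : ℝ) ≤ 2 * (p * N) := by
      have h1 := (Finset.card_le_card hsel).trans hInv.hL
      have h2 : ((S.sel I).card : ℝ) ≤ L := by exact_mod_cast h1
      linarith
    have hBI : ∀ i ∈ s.B, ¬ s.g i ⊆ I := by
      intro i hi hgi
      obtain ⟨h1, -, -, -, h5⟩ := hInv.hB i hi
      exact hI i h1 (h5.trans (Finset.union_subset hgi hInv.hY))
    by_cases hLY : L ≤ s.Y.card
    · simp only [hLY, if_true]
      have hBcard : p * e / 4 ≤ s.B.card := by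
        have h1 := hInv.hD
        have h2 : (L : ℝ) ≤ s.Y.card := by exact_mod_cast hLY
        calc p * e / 4 = D * (p * N) := by rw [hD]; field_simp
          _ ≤ D * s.Y.card := mul_le_mul_of_nonneg_left (hLge.trans h2) (by positivity)
          _ ≤ _ := h1
      have hU : HUnif k (4 * (K' + K)) p s.B s.g := by
        refine ⟨?_, fun i hi => (hInv.hB i hi).2.2.2.1, ?_⟩
        · rw [← Finset.card_pos]
          have : (0 : ℝ) < s.B.card := lt_of_lt_of_le (by positivity) hBcard
          exact_mod_cast this
        · intro T hT
          refine (hInv.hdeg T hT).trans ?_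
          obtain ⟨t, ht⟩ : ∃ t, T.card = t + 1 := ⟨T.card - 1, by have := hT.card_pos; omega⟩
          simp only [hτ, hΔ, ht, Nat.add_sub_cancel]
          rw [← add_div]
          apply div_le_div_of_nonneg_right _ hN0.le
          calc K' * p ^ (t + 1) * e + K * p ^ (t + 1) * e
              = 4 * (K' + K) * p ^ t * (p * e / 4) := by ring
            _ ≤ _ := mul_le_mul_of_nonneg_left hBcard (by positivity)
      obtain ⟨h1, h2, h3, h4⟩ := hS' s hU I hBI
      refine ⟨?_, h2, ?_, ?_⟩
      · have := Finset.card_union_le (S.sel I) ((S' s).sel I)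
        have : ((S.sel I ∪ (S' s).sel I).card : ℝ) ≤ (S.sel I).card + ((S' s).sel I).card := by
          exact_mod_cast this
        linarith
      · refine h3.trans ?_
        intro x hx
        rw [Finset.mem_biUnion] at hx ⊢
        obtain ⟨i, hi, hxi⟩ := hx
        exact ⟨i, (hInv.hB i hi).1, (hInv.hB i hi).2.2.1 hxi⟩
      · exact (mul_le_mul_of_nonneg_right (min_le_left _ _) hN0.le).trans h4
    · simp only [hLY, if_false, Scheme.const]
      refine ⟨?_, hInv.hX, hInv.hXE, ?_⟩
      · rw [Finset.union_empty]
        have : 0 < M * (p * N) := by positivity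
        linarith
      · have hlow : ∀ v, v ∉ s.X → (hdeg (s.A E f τ) f {v} : ℝ) < D := by
          rcases hFi with h | h
          · exact absurd h hLY
          · exact h
        have hhit := card_hit_le E f s.Y _ hdeg1
        have hYL : (s.Y.card : ℝ) ≤ 2 * (p * N) := by
          have : (s.Y.card : ℝ) ≤ L := by exact_mod_cast hInv.hL
          linarith
        have hhit2 : (s.Y.card : ℝ) * (K * e / N) ≤ 2 * p * K * e := by
          calc (s.Y.card : ℝ) * (K * e / N) ≤ 2 * (p * N) * (K * e / N) :=
                mul_le_mul_of_nonneg_right hYL (by positivity)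
            _ = _ := by field_simp
        have hBle : (s.B.card : ℝ) ≤ 2 * p * K * e := by
          refine le_trans ?_ (hhit.trans hhit2)
          have : s.B ⊆ E.filter fun i => ¬ Disjoint (f i) s.Y := by
            intro i hi
            rw [Finset.mem_filter]
            exact ⟨(hInv.hB i hi).1, (hInv.hB i hi).2.1⟩
          exact_mod_cast Finset.card_le_card this
        have hsat := card_sat_le E s.B f s.g k (fun i hi => (hInv.hB i hi).2.2.2.1) τ Δ
          (K / (K' * p)) (by positivity) hE.deg (by
            intro t ht
            obtain ⟨u, rfl⟩ : ∃ u, t = u + 1 := ⟨t - 1, by omega⟩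
            simp only [hτ, hΔ, Nat.add_sub_cancel]
            apply le_of_eq
            field_simp
            ring)
        have hsat2 : K / (K' * p) * (s.B.card * 2 ^ k) ≤ e / 4 := by
          calc K / (K' * p) * (s.B.card * 2 ^ k) ≤ K / (K' * p) * ((2 * p * K * e) * 2 ^ k) := by
                gcongr
            _ = e / 4 := by
                rw [hK', pow_add]
                field_simp
                norm_num
        have hA : e / 2 ≤ (s.A E f τ).card := by
          have hsub : E ⊆ s.A E f τ ∪ ((E.filter fun i => ¬ Disjoint (f i) s.Y) ∪
              (E.filter fun i => ∃ S ⊆ f i, S.Nonempty ∧ τ S.card ≤ hdeg s.B s.g S)) := by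
            intro i hi
            simp only [Finset.mem_union, CState.A, Finset.mem_filter, hi, true_and]
            by_cases h1 : Disjoint (f i) s.Y
            · by_cases h2 : ∃ S ⊆ f i, S.Nonempty ∧ τ S.card ≤ hdeg s.B s.g S
              · exact Or.inr (Or.inr h2)
              · left
                refine ⟨h1, fun S hS hS' => ?_⟩
                by_contra h
                exact h2 ⟨S, hS, hS', not_lt.1 h⟩
            · exact Or.inr (Or.inl h1)
          have h1 := Finset.card_le_card hsub
          have h2 := Finset.card_union_le (s.A E f τ) ((E.filter fun i => ¬ Disjoint (f i) s.Y) ∪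
              (E.filter fun i => ∃ S ⊆ f i, S.Nonempty ∧ τ S.card ≤ hdeg s.B s.g S))
          have h3 := Finset.card_union_le (E.filter fun i => ¬ Disjoint (f i) s.Y)
              (E.filter fun i => ∃ S ⊆ f i, S.Nonempty ∧ τ S.card ≤ hdeg s.B s.g S)
          have h4 : (E.card : ℝ) ≤ (s.A E f τ).card +
            ((E.filter fun i => ¬ Disjoint (f i) s.Y).card +
              (E.filter fun i => ∃ S ⊆ f i, S.Nonempty ∧ τ S.card ≤ hdeg s.B s.g S).card) := by
            exact_mod_cast (h1.trans h2).trans (Nat.add_le_add_left h3 _)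
          have h5 : 2 * p * K * e ≤ e / 4 := by nlinarith
          linarith
        have hsum := sum_hdeg_single (s.A E f τ) f (k + 1) (fun i hi => hE.unif i
          (Finset.filter_subset _ _ hi))
        have hsum' : ∑ v : V, (hdeg (s.A E f τ) f {v} : ℝ) = (s.A E f τ).card * (k + 1) := by
          exact_mod_cast hsum
        have hbound : ∑ v : V, (hdeg (s.A E f τ) f {v} : ℝ) ≤ N * D + s.X.card * (K * e / N) := by
          calc ∑ v : V, (hdeg (s.A E f τ) f {v} : ℝ)
              ≤ ∑ v : V, (D + if v ∈ s.X then K * e / N else 0) := by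
                apply Finset.sum_le_sum
                intro v _
                by_cases hv : v ∈ s.X
                · simp only [hv, if_true]
                  have h1 : hdeg (s.A E f τ) f {v} ≤ hdeg E f {v} := by
                    apply Finset.card_le_card
                    exact Finset.filter_subset_filter _ (Finset.filter_subset _ _)
                  have h1' : (hdeg (s.A E f τ) f {v} : ℝ) ≤ hdeg E f {v} := by exact_mod_cast h1
                  have := hdeg1 v
                  have : 0 < D := by positivity
                  linarith
                · simp only [hv, if_false, add_zero]
                  exact (hlow v hv).le
            _ = _ := by
                rw [Finset.sum_add_distrib]
                simp [hN]
        have hND : N * D = e / 4 := by rw [hD]; field_simp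
        have hA2 : (e / 2 : ℝ) ≤ (s.A E f τ).card * (k + 1) := by
          have : (0 : ℝ) ≤ (s.A E f τ).card * k := by positivity
          linarith
        have hX : e / 4 ≤ s.X.card * (K * e / N) := by linarith
        have hX2 : N / (4 * K) ≤ s.X.card := by
          rw [div_le_iff₀ (by positivity)]
          have h6 : s.X.card * (K * e / N) = (s.X.card * (4 * K)) * (e / (4 * N)) := by field_simp
          have h7 : e / 4 = N * (e / (4 * N)) := by field_simp
          rw [h6, h7] at hX
          exact le_of_mul_le_mul_right hX (by positivity)
        calc min c (1 / (4 * K)) * N ≤ 1 / (4 * K) * N :=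
              mul_le_mul_of_nonneg_right (min_le_right _ _) hN0.le
          _ = N / (4 * K) := by ring
          _ ≤ _ := hX2

theorem containers (k : ℕ) (K : ℝ) (hK : 1 ≤ K) (ε : ℝ) (hε : 0 < ε) (hε1 : ε ≤ 1) :
    ∃ M p0 : ℝ, 0 < M ∧ 0 < p0 ∧
    ∀ (V ι : Type) [Fintype V] (E : Finset ι) (f : ι → Finset V) (p : ℝ), 0 < p → p ≤ p0 →
      1 ≤ p * Fintype.card V → HUnif k K p E f →
      ∃ s : Scheme V (Finset V), ∀ I, (∀ i ∈ E, ¬ f i ⊆ I) →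
        ((s.sel I).card : ℝ) ≤ M * (p * Fintype.card V) ∧ Disjoint (s.out I) I ∧
        ((E.filter fun i => Disjoint (f i) (s.out I)).card : ℝ) < ε * E.card := by
  obtain ⟨c, M, p0, hc, hM, hp0, H⟩ := one_step k (K / ε) (by rw [le_div_iff₀ hε]; linarith)
  obtain ⟨J, hJ⟩ := exists_nat_gt (1 / c)
  have hJ0 : (0 : ℝ) < J := lt_trans (by positivity) hJ
  refine ⟨J * M, p0, by positivity, hp0, ?_⟩
  intro V ι _ E f p hp hpp hpN hE
  set N : ℝ := (Fintype.card V : ℝ) with hN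
  have hN0 : 0 < N := by
    by_contra h
    have : N ≤ 0 := not_lt.1 h
    nlinarith
  have key : ∀ j : ℕ, ∃ s : Scheme V (Finset V), ∀ I, (∀ i ∈ E, ¬ f i ⊆ I) →
        ((s.sel I).card : ℝ) ≤ j * M * (p * N) ∧ Disjoint (s.out I) I ∧
        (((E.filter fun i => Disjoint (f i) (s.out I)).card : ℝ) < ε * E.card ∨
          j * (c * N) ≤ (s.out I).card) := by
    intro j
    induction j with
    | zero =>
      refine ⟨Scheme.const ∅, fun I hI => ?_⟩
      simp [Scheme.const]
    | succ j ih =>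
      obtain ⟨s, hs⟩ := ih
      have hex : ∀ X : Finset V, ∃ S' : Scheme V (Finset V),
          ¬ (((E.filter fun i => Disjoint (f i) X).card : ℝ) < ε * E.card) →
          ∀ I, (∀ i ∈ E, ¬ f i ⊆ I) →
          ((S'.sel I).card : ℝ) ≤ M * (p * N) ∧ Disjoint (S'.out I) I ∧
          S'.out I ⊆ (E.filter fun i => Disjoint (f i) X).biUnion f ∧
          c * N ≤ ((S'.out I).card : ℝ) := by
        intro X
        by_cases h : ((E.filter fun i => Disjoint (f i) X).card : ℝ) < ε * E.card
        · exact ⟨Scheme.const ∅, fun h' => absurd h h'⟩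
        · rw [not_lt] at h
          have he0 : (0 : ℝ) < E.card := by
            have := hE.ne.card_pos
            exact_mod_cast this
          have hU : HUnif k (K / ε) p (E.filter fun i => Disjoint (f i) X) f := by
            refine ⟨?_, fun i hi => hE.unif i (Finset.filter_subset _ _ hi), ?_⟩
            · rw [← Finset.card_pos]
              have : (0 : ℝ) < (E.filter fun i => Disjoint (f i) X).card :=
                lt_of_lt_of_le (by positivity) h
              exact_mod_cast this
            · intro S hS
              have h1 : hdeg (E.filter fun i => Disjoint (f i) X) f S ≤ hdeg E f S :=
                Finset.card_le_card (Finset.filter_subset_filter _ (Finset.filter_subset _ _))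
              have h1' : (hdeg (E.filter fun i => Disjoint (f i) X) f S : ℝ) ≤ hdeg E f S := by
                exact_mod_cast h1
              refine h1'.trans ((hE.deg S hS).trans ?_)
              apply div_le_div_of_nonneg_right _ hN0.le
              calc K * p ^ (S.card - 1) * E.card
                  = K / ε * p ^ (S.card - 1) * (ε * E.card) := by field_simp
                _ ≤ _ := mul_le_mul_of_nonneg_left h (by positivity)
          obtain ⟨S', hS'⟩ := H V ι _ f p hp hpp hpN hU
          exact ⟨S', fun _ I hI => hS' I (fun i hi => hI i (Finset.filter_subset _ _ hi))⟩
      choose S' hS' using hex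
      have hexb : ∀ X : Finset V, ∃ b : Scheme V (Finset V),
          (((E.filter fun i => Disjoint (f i) X).card : ℝ) < ε * E.card → b = Scheme.const X) ∧
          (¬ ((E.filter fun i => Disjoint (f i) X).card : ℝ) < ε * E.card →
            b = (S' X).bind fun X' => Scheme.const (X ∪ X')) := by
        intro X
        by_cases h : ((E.filter fun i => Disjoint (f i) X).card : ℝ) < ε * E.card
        · exact ⟨_, fun _ => rfl, fun h' => absurd h h'⟩
        · exact ⟨_, fun h' => absurd h' h, fun _ => rfl⟩
      choose b hb1 hb2 using hexb
      refine ⟨s.bind b, fun I hI => ?_⟩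
      obtain ⟨h1, h2, h3⟩ := hs I hI
      have hpos : 0 < M * (p * N) := by positivity
      by_cases h : ((E.filter fun i => Disjoint (f i) (s.out I)).card : ℝ) < ε * E.card
      · have e1 : (s.bind b).sel I = s.sel I := by
          rw [Scheme.bind_sel, hb1 _ h, Scheme.const_sel, Finset.union_empty]
        have e2 : (s.bind b).out I = s.out I := by
          rw [Scheme.bind_out, hb1 _ h, Scheme.const_out]
        rw [e1, e2]
        refine ⟨?_, h2, Or.inl h⟩
        push_cast
        linarith
      · have e1 : (s.bind b).sel I = s.sel I ∪ (S' (s.out I)).sel I := by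
          rw [Scheme.bind_sel, hb2 _ h, Scheme.bind_sel, Scheme.const_sel, Finset.union_empty]
        have e2 : (s.bind b).out I = s.out I ∪ (S' (s.out I)).out I := by
          rw [Scheme.bind_out, hb2 _ h, Scheme.bind_out, Scheme.const_out]
        rw [e1, e2]
        obtain ⟨a, b', c', d⟩ := hS' (s.out I) h I hI
        refine ⟨?_, Finset.disjoint_union_left.2 ⟨h2, b'⟩, Or.inr ?_⟩
        · have := Finset.card_union_le (s.sel I) ((S' (s.out I)).sel I)
          have : ((s.sel I ∪ (S' (s.out I)).sel I).card : ℝ)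
              ≤ (s.sel I).card + ((S' (s.out I)).sel I).card := by
            exact_mod_cast this
          push_cast
          linarith
        · have hd : Disjoint (s.out I) ((S' (s.out I)).out I) := by
            rw [Finset.disjoint_right]
            intro x hx hxX
            have := c' hx
            rw [Finset.mem_biUnion] at this
            obtain ⟨i, hi, hxi⟩ := this
            rw [Finset.mem_filter] at hi
            exact Finset.disjoint_left.1 hi.2 hxi hxX
          rw [Finset.card_union_of_disjoint hd]
          have h3' := h3.resolve_left h
          push_cast
          linarith
  obtain ⟨s, hs⟩ := key J
  refine ⟨s, fun I hI => ?_⟩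
  obtain ⟨h1, h2, h3⟩ := hs I hI
  refine ⟨h1, h2, h3.resolve_right ?_⟩
  intro h
  have h4 : ((s.out I).card : ℝ) ≤ N := by
    exact Nat.cast_le.2 (Finset.card_le_univ (s.out I))
  have h5 : 1 < J * c := by rwa [div_lt_iff₀ hc] at hJ
  nlinarith

theorem m2_ge {α : Type} [Fintype α] (H : SimpleGraph α) (s : Finset α) (hs : 3 ≤ s.card)
    (T : Finset (Sym2 α)) (hT : ∀ e ∈ T, e ∈ H.edgeSet ∧ ∀ v ∈ e, v ∈ s) :
    (T.card : ℝ) - 1 ≤ m2 H * ((s.card : ℝ) - 2) := by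
  have h3 : (3 : ℝ) ≤ s.card := by exact_mod_cast hs
  have hcard : T.card ≤ Nat.card {e : Sym2 α // e ∈ H.edgeSet ∧ ∀ v ∈ e, v ∈ s} := by
    rw [Nat.card_eq_fintype_card, Fintype.card_subtype]
    apply Finset.card_le_card
    intro e he
    simpa using hT e he
  have hcard' : (T.card : ℝ) ≤ Nat.card {e : Sym2 α // e ∈ H.edgeSet ∧ ∀ v ∈ e, v ∈ s} := by
    exact_mod_cast hcard
  have hle : ((Nat.card {e : Sym2 α // e ∈ H.edgeSet ∧ ∀ v ∈ e, v ∈ s} : ℝ) - 1) /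
      ((s.card : ℝ) - 2) ≤ m2 H := by
    apply le_csSup
    · apply Set.Finite.bddAbove
      apply Set.Finite.subset (Set.finite_range (fun s : Finset α =>
        ((Nat.card {e : Sym2 α // e ∈ H.edgeSet ∧ ∀ v ∈ e, v ∈ s} : ℝ) - 1) /
      ((s.card : ℝ) - 2)))
      rintro x ⟨s, -, rfl⟩
      exact ⟨s, rfl⟩
    · exact ⟨s, hs, rfl⟩
  rw [div_le_iff₀ (by linarith)] at hle
  linarith

theorem m2_ge_one {α : Type} [Fintype α] (H : SimpleGraph α) (hH : ¬ H.Colorable 2) :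
    1 ≤ m2 H := by
  by_cases h : ∃ a b c, H.Adj a b ∧ H.Adj a c ∧ b ≠ c
  · obtain ⟨a, b, c, h1, h2, h3⟩ := h
    have hab := h1.ne
    have hac := h2.ne
    have hcard : ({a, b, c} : Finset α).card = 3 := by
      rw [Finset.card_eq_three]; exact ⟨a, b, c, hab, hac, h3, rfl⟩
    have := m2_ge H {a, b, c} hcard.ge {s(a, b), s(a, c)} (by
      intro e he
      simp only [Finset.mem_insert, Finset.mem_singleton] at he
      rcases he with rfl | rfl
      · simp [h1]
      · simp [h2])
    rw [hcard, Finset.card_pair (by simp; tauto)] at this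
    norm_num at this
    linarith
  · exfalso
    push Not at h
    apply hH
    let _ : LinearOrder α := IsWellOrder.linearOrder WellOrderingRel
    rw [SimpleGraph.colorable_iff_exists_bdd_nat_coloring]
    refine ⟨SimpleGraph.Coloring.mk (fun v => if ∃ w, H.Adj v w ∧ w < v then 1 else 0) ?_, ?_⟩
    · intro v w hvw
      rcases lt_trichotomy v w with hlt | heq | hlt
      · have h1 : ∃ u, H.Adj w u ∧ u < w := ⟨v, hvw.symm, hlt⟩
        have h2 : ¬ ∃ u, H.Adj v u ∧ u < v := by
          rintro ⟨u, hu, hu'⟩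
          have := h v u w hu hvw
          subst this
          exact absurd hlt (not_lt.2 hu'.le)
        simp [h1, h2]
      · exact absurd heq hvw.ne
      · have h1 : ∃ u, H.Adj v u ∧ u < v := ⟨w, hvw, hlt⟩
        have h2 : ¬ ∃ u, H.Adj w u ∧ u < w := by
          rintro ⟨u, hu, hu'⟩
          have := h w u v hu hvw.symm
          subst this
          exact absurd hlt (not_lt.2 hu'.le)
        simp [h1, h2]
    · intro v
      show (if ∃ w, H.Adj v w ∧ w < v then 1 else 0) < 2
      split_ifs <;> norm_num

/-- vertices covered by a set of pairs -/
noncomputable def cover {β : Type} [Fintype β] (T : Finset (Sym2 β)) : Finset β :=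
  Finset.univ.filter fun v => ∃ e ∈ T, v ∈ e

theorem card_cover_le {β : Type} [Fintype β] (T : Finset (Sym2 β)) :
    (cover T).card ≤ 2 * T.card := by
  have : cover T ⊆ T.biUnion fun e => Finset.univ.filter fun v => v ∈ e := by
    intro v hv
    simpa [cover] using hv
  refine (Finset.card_le_card this).trans ?_
  rw [mul_comm]
  apply Finset.card_biUnion_le_card_mul
  intro e _
  induction e with
  | h a b =>
    have : (Finset.univ.filter fun v => v ∈ s(a, b)) ⊆ {a, b} := by
      intro v hv
      simpa using hv
    exact (Finset.card_le_card this).trans Finset.card_le_two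

theorem m2_cover {α : Type} [Fintype α] (H : SimpleGraph α) (T : Finset (Sym2 α))
    (hT : ∀ e ∈ T, e ∈ H.edgeSet) (hne : T.Nonempty) :
    2 ≤ (cover T).card ∧ (T.card : ℝ) - 1 ≤ m2 H * (((cover T).card : ℝ) - 2) := by
  have h2 : 2 ≤ (cover T).card := by
    obtain ⟨e, he⟩ := hne
    have hh := hT e he
    induction e with
    | h a b =>
      rw [SimpleGraph.mem_edgeSet] at hh
      rw [← Finset.card_pair hh.ne]
      apply Finset.card_le_card
      intro v hv
      simp only [cover, Finset.mem_filter, Finset.mem_univ, true_and]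
      refine ⟨_, he, ?_⟩
      simpa using hv
  refine ⟨h2, ?_⟩
  rcases h2.lt_or_eq with h3 | h3
  · apply m2_ge H (cover T) h3
    intro e he
    refine ⟨hT e he, fun v hv => ?_⟩
    simp only [cover, Finset.mem_filter, Finset.mem_univ, true_and]
    exact ⟨e, he, hv⟩
  · have : T.card ≤ 1 := by
      obtain ⟨x, y, hxy, hc⟩ := Finset.card_eq_two.1 h3.symm
      have key : ∀ e ∈ T, e = s(x, y) := by
        intro e he
        have hh := hT e he
        have hm : ∀ v ∈ e, v = x ∨ v = y := by
          intro v hv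
          have : v ∈ cover T := by
            simp only [cover, Finset.mem_filter, Finset.mem_univ, true_and]
            exact ⟨e, he, hv⟩
          rw [hc] at this
          simpa using this
        induction e with
        | h a b =>
          rw [SimpleGraph.mem_edgeSet] at hh
          have h1 := hm a (by simp)
          have h2 := hm b (by simp)
          have h3 := hh.ne
          rw [Sym2.eq_iff]
          rcases h1 with rfl | rfl <;> rcases h2 with rfl | rfl <;> tauto
      rw [Finset.card_le_one]
      intro a ha b hb
      rw [key a ha, key b hb]
    have : (T.card : ℝ) ≤ 1 := by exact_mod_cast this
    rw [← h3]
    push_cast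
    linarith

/-- the injective maps -/
noncomputable def injs (α : Type) [Fintype α] (n : ℕ) : Finset (α → Fin n) :=
  Finset.univ.filter fun φ => Function.Injective φ

/-- the edges of the copy of `H` given by `φ` -/
noncomputable def cp {α β : Type} [Fintype α] (H : SimpleGraph α) (φ : α → β) : Finset (Sym2 β) :=
  H.edgeFinset.image (Sym2.map φ)

theorem mem_cp {α β : Type} [Fintype α] (H : SimpleGraph α) (φ : α → β) (x : Sym2 β) :
    x ∈ cp H φ ↔ ∃ e ∈ H.edgeFinset, Sym2.map φ e = x := by
  rw [cp, Finset.mem_image]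

theorem card_cp {α β : Type} [Fintype α] (H : SimpleGraph α) (φ : α → β)
    (h : Function.Injective φ) : (cp H φ).card = H.edgeFinset.card := by
  rw [cp, Finset.card_image_of_injective _ (Sym2.map.injective h)]

theorem card_injs (α : Type) [Fintype α] (n : ℕ) :
    (injs α n).card = n.descFactorial (Fintype.card α) := by
  have h := Fintype.card_embedding_eq (α := α) (β := Fin n)
  rw [Fintype.card_fin] at h
  rw [← h, ← Fintype.card_congr (Equiv.subtypeInjectiveEquivEmbedding α (Fin n)),
    Fintype.card_subtype]
  rfl

theorem card_injs_ge (α : Type) [Fintype α] (n : ℕ) (hn : 0 < n) (hv : Fintype.card α ≤ n) :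
    (n : ℝ) ^ (Fintype.card α) * (1 - (Fintype.card α : ℝ) ^ 2 / n) ≤ ((injs α n).card : ℝ) := by
  rw [card_injs]
  set v := Fintype.card α
  have h1 := Nat.pow_sub_le_descFactorial n v
  have h1' : ((n + 1 - v : ℕ) : ℝ) ^ v ≤ (n.descFactorial v : ℝ) := by exact_mod_cast h1
  refine le_trans ?_ h1'
  have hn' : (0 : ℝ) < n := by exact_mod_cast hn
  have hv' : (v : ℝ) ≤ n := by exact_mod_cast hv
  have h2 : ((n : ℝ) - v) ^ v ≤ ((n + 1 - v : ℕ) : ℝ) ^ v := by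
    apply pow_le_pow_left₀ (by linarith)
    rw [Nat.cast_sub (by omega)]
    push_cast
    linarith
  refine le_trans ?_ h2
  have h3 := one_add_mul_le_pow (a := -((v : ℝ) / n)) (by
    have : (v : ℝ) / n ≤ 1 := by rw [div_le_one hn']; exact hv'
    linarith) v
  have h4 : ((n : ℝ) - v) = n * (1 + -((v : ℝ) / n)) := by field_simp; ring
  rw [h4, mul_pow]
  apply mul_le_mul_of_nonneg_left _ (by positivity)
  refine le_trans (le_of_eq ?_) h3
  ring

theorem hdeg_copies {α : Type} [Fintype α] (H : SimpleGraph α) (hm : 1 ≤ m2 H) (n : ℕ)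
    (hn : 1 ≤ n) (hv : 2 ≤ Fintype.card α)
    (S : Finset (Sym2 (Fin n))) (hS : S.Nonempty) :
    (hdeg (injs α n) (cp H) S : ℝ) ≤
      2 ^ H.edgeFinset.card * (2 * H.edgeFinset.card : ℝ) ^ (Fintype.card α) *
      ((n : ℝ) ^ (Fintype.card α - 2) * ((n : ℝ) ^ (-(1 / m2 H))) ^ (S.card - 1)) := by
  set ℓ := H.edgeFinset.card with hℓ
  set v := Fintype.card α with hvd
  set p : ℝ := (n : ℝ) ^ (-(1 / m2 H)) with hp
  have hn' : (1 : ℝ) ≤ n := by exact_mod_cast hn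
  have hsub : (injs α n).filter (fun φ => S ⊆ cp H φ) ⊆
      (H.edgeFinset.powersetCard S.card).biUnion fun T =>
        Fintype.piFinset fun a => if a ∈ cover T then cover S else Finset.univ := by
    intro φ hφ
    rw [Finset.mem_filter, injs, Finset.mem_filter] at hφ
    obtain ⟨⟨-, hi⟩, hs⟩ := hφ
    rw [Finset.mem_biUnion]
    have himg : (H.edgeFinset.filter fun e => Sym2.map φ e ∈ S).image (Sym2.map φ) = S := by
      ext x
      simp only [Finset.mem_image, Finset.mem_filter]
      constructor
      · rintro ⟨e, ⟨-, h⟩, rfl⟩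
        exact h
      · intro hx
        have := hs hx
        rw [mem_cp] at this
        obtain ⟨e, he, rfl⟩ := this
        exact ⟨e, ⟨he, hx⟩, rfl⟩
    refine ⟨H.edgeFinset.filter fun e => Sym2.map φ e ∈ S, ?_, ?_⟩
    · rw [Finset.mem_powersetCard]
      refine ⟨Finset.filter_subset _ _, ?_⟩
      conv_rhs => rw [← himg]
      rw [Finset.card_image_of_injective _ (Sym2.map.injective hi)]
    · rw [Fintype.mem_piFinset]
      intro a
      split_ifs with ha
      · simp only [cover, Finset.mem_filter, Finset.mem_univ, true_and] at ha ⊢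
        obtain ⟨e, he, hae⟩ := ha
        exact ⟨_, he.2, Sym2.mem_map.2 ⟨a, hae, rfl⟩⟩
      · exact Finset.mem_univ _
  have h1 : (hdeg (injs α n) (cp H) S : ℝ) ≤ ∑ T ∈ H.edgeFinset.powersetCard S.card,
      ((Fintype.piFinset fun a => if a ∈ cover T then cover S else Finset.univ).card : ℝ) := by
    have := (Finset.card_le_card hsub).trans Finset.card_biUnion_le
    have h0 : hdeg (injs α n) (cp H) S ≤ ∑ T ∈ H.edgeFinset.powersetCard S.card,
      (Fintype.piFinset fun a => if a ∈ cover T then cover S else Finset.univ).card := by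
      refine le_trans (le_of_eq ?_) this
      unfold hdeg
      congr
    exact_mod_cast h0
  refine h1.trans ?_
  have hnum : ((H.edgeFinset.powersetCard S.card).card : ℝ) ≤ 2 ^ ℓ := by
    have : (H.edgeFinset.powersetCard S.card).card ≤ 2 ^ ℓ := by
      rw [Finset.card_powersetCard]
      exact Nat.choose_le_two_pow _ _
    exact_mod_cast this
  have hterm : ∀ T ∈ H.edgeFinset.powersetCard S.card,
      ((Fintype.piFinset fun a => if a ∈ cover T then cover S else Finset.univ).card : ℝ) ≤
        (2 * ℓ : ℝ) ^ v * ((n : ℝ) ^ (v - 2) * p ^ (S.card - 1)) := by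
    intro T hT
    rw [Finset.mem_powersetCard] at hT
    obtain ⟨hT1, hT2⟩ := hT
    have hTne : T.Nonempty := by
      rw [← Finset.card_pos, hT2, Finset.card_pos]; exact hS
    obtain ⟨hc2, hc⟩ := m2_cover H T (fun e he => by simpa using hT1 he) hTne
    have hSl : S.card ≤ ℓ := by rw [← hT2]; exact Finset.card_le_card hT1
    have hl1 : 1 ≤ ℓ := le_trans (Finset.card_pos.2 hS) hSl
    set w := (cover T).card with hw
    have hwv : w ≤ v := Finset.card_le_univ _
    have hcard : (Fintype.piFinset fun a => if a ∈ cover T then cover S else Finset.univ).card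
        = (cover S).card ^ w * n ^ (v - w) := by
      rw [Fintype.card_piFinset]
      have : ∀ a, (if a ∈ cover T then cover S else (Finset.univ : Finset (Fin n))).card
          = if a ∈ cover T then (cover S).card else n := by
        intro a; split_ifs <;> simp
      simp only [this]
      rw [Finset.prod_ite, Finset.prod_const, Finset.prod_const]
      have e1 : (Finset.univ.filter fun a => a ∈ cover T) = cover T := by ext; simp
      have e2 : (Finset.univ.filter fun a => ¬ a ∈ cover T) = (cover T)ᶜ := by ext; simp
      rw [e1, e2, Finset.card_compl]
    rw [hcard]
    push_cast
    have hA : ((cover S).card : ℝ) ^ w ≤ (2 * ℓ : ℝ) ^ v := by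
      have h2l : (1 : ℝ) ≤ 2 * ℓ := by
        have : (1 : ℝ) ≤ ℓ := by exact_mod_cast hl1
        linarith
      have : ((cover S).card : ℝ) ≤ 2 * ℓ := by
        have := (card_cover_le S).trans (Nat.mul_le_mul_left 2 hSl)
        exact_mod_cast this
      exact (pow_le_pow_left₀ (by positivity) this w).trans (pow_le_pow_right₀ h2l hwv)
    have hB : (n : ℝ) ^ (v - w) ≤ (n : ℝ) ^ (v - 2) * p ^ (S.card - 1) := by
      have hs1 : 1 ≤ S.card := Finset.card_pos.2 hS
      rw [hp, ← Real.rpow_natCast, ← Real.rpow_natCast, ← Real.rpow_natCast,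
        ← Real.rpow_mul (by linarith), ← Real.rpow_add (by linarith)]
      apply Real.rpow_le_rpow_of_exponent_le hn'
      rw [Nat.cast_sub hwv, Nat.cast_sub hv, Nat.cast_sub hs1]
      rw [hT2] at hc
      have : (1 / m2 H) * ((S.card : ℝ) - 1) ≤ (w : ℝ) - 2 := by
        rw [one_div, inv_mul_le_iff₀ (by linarith)]
        exact hc
      push_cast
      linarith
    exact mul_le_mul hA hB (by positivity) (by positivity)
  refine (Finset.sum_le_sum hterm).trans ?_
  rw [Finset.sum_const, nsmul_eq_mul, mul_assoc]
  exact mul_le_mul_of_nonneg_right hnum (by positivity)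

theorem card_sym2_fin_le (n : ℕ) (hn : 1 ≤ n) : (Fintype.card (Sym2 (Fin n)) : ℝ) ≤ (n : ℝ) ^ 2 ∧
    (n : ℝ) ^ 2 / 2 ≤ (Fintype.card (Sym2 (Fin n)) : ℝ) := by
  rw [Sym2.card, Fintype.card_fin, Nat.cast_choose_two]
  push_cast
  have : (1 : ℝ) ≤ n := by exact_mod_cast hn
  constructor <;> nlinarith

/-- The copies of `H` form a well-distributed hypergraph. -/
theorem HUnif_copies {α : Type} [Fintype α] (H : SimpleGraph α) (hm : 1 ≤ m2 H)
    (hv : 2 ≤ Fintype.card α) (hl : 1 ≤ H.edgeFinset.card) :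
    ∃ K : ℝ, 1 ≤ K ∧ ∀ n : ℕ, 2 * (Fintype.card α) ^ 2 ≤ n →
      HUnif H.edgeFinset.card K ((n : ℝ) ^ (-(1 / m2 H))) (injs α n) (cp H) := by
  set ℓ := H.edgeFinset.card with hℓ
  set v := Fintype.card α with hvd
  have hl' : (1 : ℝ) ≤ ℓ := by exact_mod_cast hl
  refine ⟨2 * (2 ^ ℓ * (2 * ℓ : ℝ) ^ v), ?_, ?_⟩
  · have h1 : (1 : ℝ) ≤ 2 ^ ℓ := one_le_pow₀ (by norm_num)
    have h2 : (1 : ℝ) ≤ (2 * ℓ) ^ v := one_le_pow₀ (by linarith)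
    nlinarith
  · intro n hn
    have hvn : v ≤ n := by nlinarith
    have hn1 : 1 ≤ n := by omega
    have hn1' : (1 : ℝ) ≤ n := by exact_mod_cast hn1
    have hE := card_injs_ge α n hn1 hvn
    have hE2 : (n : ℝ) ^ v / 2 ≤ ((injs α n).card : ℝ) := by
      refine le_trans ?_ hE
      have : (v : ℝ) ^ 2 / n ≤ 1 / 2 := by
        rw [div_le_iff₀ (by linarith)]
        have : (2 * v ^ 2 : ℝ) ≤ n := by exact_mod_cast hn
        linarith
      have h0 : (0 : ℝ) ≤ (n : ℝ) ^ v := by positivity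
      nlinarith
    refine ⟨?_, ?_, ?_⟩
    · rw [← Finset.card_pos]
      have : (0 : ℝ) < (injs α n).card := lt_of_lt_of_le (by positivity) hE2
      exact_mod_cast this
    · intro φ hφ
      rw [injs, Finset.mem_filter] at hφ
      rw [card_cp H φ hφ.2]
    · intro S hS
      refine (hdeg_copies H hm n hn1 hv S hS).trans ?_
      obtain ⟨hN, hN2⟩ := card_sym2_fin_le n hn1
      have hN0 : (0 : ℝ) < Fintype.card (Sym2 (Fin n)) := lt_of_lt_of_le (by positivity) hN2
      rw [le_div_iff₀ hN0]
      have hvv : (n : ℝ) ^ v = (n : ℝ) ^ (v - 2) * (n : ℝ) ^ 2 := by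
        rw [← pow_add]; congr 1; omega
      set p : ℝ := ((n : ℝ) ^ (-(1 / m2 H))) ^ (S.card - 1)
      have hp0 : 0 ≤ p := by positivity
      set A : ℝ := 2 ^ ℓ * (2 * ℓ : ℝ) ^ v with hA
      have hA0 : 0 ≤ A := by positivity
      calc A * ((n : ℝ) ^ (v - 2) * p) * (Fintype.card (Sym2 (Fin n)))
          ≤ A * ((n : ℝ) ^ (v - 2) * p) * (n : ℝ) ^ 2 :=
            mul_le_mul_of_nonneg_left hN (by positivity)
        _ = A * p * (n : ℝ) ^ v := by rw [hvv]; ring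
        _ ≤ A * p * (2 * (injs α n).card) :=
            mul_le_mul_of_nonneg_left (by linarith) (by positivity)
        _ = _ := by ring

/-- the neighbours of `x` in `A` -/
noncomputable def nb {V : Type} (G : SimpleGraph V) (A : Finset V) (x : V) : Finset V :=
  A.filter (G.Adj x)

/-- number of ordered `k`-cliques in `A` -/
noncomputable def cnt {V : Type} (G : SimpleGraph V) : ℕ → Finset V → ℕ
  | 0, _ => 1
  | k + 1, A => ∑ x ∈ A, cnt G k (nb G A x)

noncomputable def adjI {V : Type} (G : SimpleGraph V) (x y : V) : ℝ := if G.Adj x y then 1 else 0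

noncomputable def exc {V : Type} (G : SimpleGraph V) (c : V → ℕ) (A : Finset V) : ℝ :=
  ∑ x ∈ A, ∑ y ∈ A, if c x = c y then 2 * adjI G x y else adjI G x y - 1

theorem adjI_comm {V : Type} (G : SimpleGraph V) (x y : V) : adjI G x y = adjI G y x := by
  unfold adjI; rw [G.adj_comm]

theorem adjI_nonneg {V : Type} (G : SimpleGraph V) (x y : V) : 0 ≤ adjI G x y := by
  unfold adjI; split_ifs <;> norm_num

theorem adjI_le_one {V : Type} (G : SimpleGraph V) (x y : V) : adjI G x y ≤ 1 := by
  unfold adjI; split_ifs <;> norm_num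

theorem sum_adjI {V : Type} (G : SimpleGraph V) (A : Finset V) (x : V) :
    ∑ y ∈ A, adjI G x y = (nb G A x).card := by
  unfold adjI nb
  rw [Finset.sum_boole]

theorem exc_split {V : Type} (G : SimpleGraph V) (c c' : V → ℕ) (r : ℕ) (A A' : Finset V)
    (hA : A' ⊆ A) (hc : ∀ x, c' x < r) (h1 : ∀ x ∈ A', c x = c' x) (h2 : ∀ x ∈ A \ A', c x = r) :
    exc G c A = exc G c' A' + 2 * ∑ y ∈ A \ A', (((nb G A y).card : ℝ) - A'.card) := by
  have key : ∀ g : V → V → ℝ, ∑ x ∈ A, ∑ y ∈ A, g x y =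
      ∑ x ∈ A \ A', ∑ y ∈ A \ A', g x y + ∑ x ∈ A \ A', ∑ y ∈ A', g x y +
      (∑ x ∈ A', ∑ y ∈ A \ A', g x y + ∑ x ∈ A', ∑ y ∈ A', g x y) := by
    intro g
    rw [← Finset.sum_sdiff hA, ← Finset.sum_add_distrib, ← Finset.sum_add_distrib]
    congr 1 <;> · apply Finset.sum_congr rfl; intro x _; rw [Finset.sum_sdiff hA]
  unfold exc
  rw [key]
  have e1 : ∑ x ∈ A \ A', ∑ y ∈ A \ A', (if c x = c y then 2 * adjI G x y else adjI G x y - 1)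
      = 2 * ∑ x ∈ A \ A', ∑ y ∈ A \ A', adjI G x y := by
    rw [Finset.mul_sum]
    apply Finset.sum_congr rfl; intro x hx
    rw [Finset.mul_sum]
    apply Finset.sum_congr rfl; intro y hy
    rw [h2 x hx, h2 y hy, if_pos rfl]
  have e2 : ∑ x ∈ A \ A', ∑ y ∈ A', (if c x = c y then 2 * adjI G x y else adjI G x y - 1)
      = ∑ x ∈ A \ A', ∑ y ∈ A', (adjI G x y - 1) := by
    apply Finset.sum_congr rfl; intro x hx
    apply Finset.sum_congr rfl; intro y hy
    rw [h2 x hx, h1 y hy, if_neg (hc y).ne']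
  have e3 : ∑ x ∈ A', ∑ y ∈ A \ A', (if c x = c y then 2 * adjI G x y else adjI G x y - 1)
      = ∑ x ∈ A \ A', ∑ y ∈ A', (adjI G x y - 1) := by
    rw [Finset.sum_comm]
    apply Finset.sum_congr rfl; intro x hx
    apply Finset.sum_congr rfl; intro y hy
    rw [h2 x hx, h1 y hy, if_neg (hc y).ne, adjI_comm]
  have e4 : ∑ x ∈ A', ∑ y ∈ A', (if c x = c y then 2 * adjI G x y else adjI G x y - 1)
      = ∑ x ∈ A', ∑ y ∈ A', (if c' x = c' y then 2 * adjI G x y else adjI G x y - 1) := by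
    apply Finset.sum_congr rfl; intro x hx
    apply Finset.sum_congr rfl; intro y hy
    rw [h1 x hx, h1 y hy]
  rw [e1, e2, e3, e4]
  have e5 : ∑ y ∈ A \ A', (((nb G A y).card : ℝ) - A'.card) =
      ∑ x ∈ A \ A', ∑ y ∈ A \ A', adjI G x y + ∑ x ∈ A \ A', ∑ y ∈ A', (adjI G x y - 1) := by
    rw [← Finset.sum_add_distrib]
    apply Finset.sum_congr rfl; intro x hx
    rw [← sum_adjI, ← Finset.sum_sdiff hA, Finset.sum_sub_distrib]
    simp
    ring
  rw [e5]
  ring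

theorem stability (r : ℕ) : ∀ ε' : ℝ, 0 < ε' → ∃ ε : ℝ, 0 < ε ∧
    ∀ (V : Type) [Fintype V] (G : SimpleGraph V) (A : Finset V),
      (cnt G (r + 2) A : ℝ) ≤ ε * (Fintype.card V : ℝ) ^ (r + 2) →
      ∃ c : V → ℕ, (∀ x, c x < r + 1) ∧ exc G c A ≤ ε' * (Fintype.card V : ℝ) ^ 2 := by
  induction r with
  | zero =>
    intro ε' hε'
    refine ⟨ε' / 2, by positivity, ?_⟩
    intro V _ G A h
    refine ⟨fun _ => 0, by simp, ?_⟩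
    have : exc G (fun _ => 0) A = 2 * (cnt G 2 A : ℝ) := by
      simp only [exc, if_true, cnt, Nat.cast_sum]
      rw [Finset.mul_sum]
      apply Finset.sum_congr rfl; intro x _
      rw [← Finset.mul_sum, sum_adjI]
      simp
    rw [this]
    simp only [zero_add] at h
    linarith
  | succ r ih =>
    intro ε' hε'
    obtain ⟨ε1, hε1, H⟩ := ih (ε' / 2) (by positivity)
    set s := min ε1 (ε' / 4) with hs
    have hs0 : 0 < s := lt_min hε1 (by positivity)
    have hs1 : s ≤ ε1 := min_le_left _ _
    have hs2 : s ≤ ε' / 4 := min_le_right _ _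
    refine ⟨s ^ 2, by positivity, ?_⟩
    intro V _ G A h
    set n : ℝ := (Fintype.card V : ℝ) with hn
    rcases isEmpty_or_nonempty V with hV | hV
    · refine ⟨fun _ => 0, by simp, ?_⟩
      have : A = ∅ := Finset.eq_empty_of_isEmpty A
      subst this
      simp only [exc, Finset.sum_empty]
      positivity
    have hn0 : 0 < n := by rw [hn]; exact Nat.cast_pos.2 Fintype.card_pos
    have hdeg : ∀ x, ((nb G A x).card : ℝ) ≤ n := by
      intro x; exact Nat.cast_le.2 (Finset.card_le_univ _)
    set B := A.filter fun x => s * n ^ (r + 2) < (cnt G (r + 2) (nb G A x) : ℝ) with hB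
    have hBc : (B.card : ℝ) ≤ s * n := by
      have h1 : (B.card : ℝ) * (s * n ^ (r + 2)) ≤ s ^ 2 * n ^ (r + 3) := by
        calc (B.card : ℝ) * (s * n ^ (r + 2)) = ∑ x ∈ B, s * n ^ (r + 2) := by
              rw [Finset.sum_const, nsmul_eq_mul]
          _ ≤ ∑ x ∈ B, (cnt G (r + 2) (nb G A x) : ℝ) :=
              Finset.sum_le_sum fun x hx => (Finset.mem_filter.1 hx).2.le
          _ ≤ ∑ x ∈ A, (cnt G (r + 2) (nb G A x) : ℝ) :=
              Finset.sum_le_sum_of_subset_of_nonneg (Finset.filter_subset _ _)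
                (fun _ _ _ => Nat.cast_nonneg _)
          _ = (cnt G (r + 3) A : ℝ) := by
              rw [← Nat.cast_sum]; rfl
          _ ≤ _ := h
      have h2 : s ^ 2 * n ^ (r + 3) = (s * n) * (s * n ^ (r + 2)) := by ring
      rw [h2] at h1
      exact le_of_mul_le_mul_right h1 (by positivity)
    by_cases hg : (A \ B).Nonempty
    · obtain ⟨x, hx, hmax⟩ := Finset.exists_max_image (A \ B) (fun x => (nb G A x).card) hg
      rw [Finset.mem_sdiff] at hx
      have hxB : (cnt G (r + 2) (nb G A x) : ℝ) ≤ s * n ^ (r + 2) := by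
        by_contra hh
        exact hx.2 (Finset.mem_filter.2 ⟨hx.1, not_le.1 hh⟩)
      obtain ⟨c', hc', hexc⟩ := H V G (nb G A x)
        (hxB.trans (mul_le_mul_of_nonneg_right hs1 (by positivity)))
      refine ⟨fun y => if y ∈ nb G A x then c' y else r + 1, ?_, ?_⟩
      · intro y
        dsimp only
        split_ifs
        · exact (hc' y).trans (by omega)
        · omega
      · rw [exc_split G _ c' (r + 1) A (nb G A x) (Finset.filter_subset _ _) hc'
          (fun y hy => if_pos hy) (fun y hy => if_neg (Finset.mem_sdiff.1 hy).2)]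
        have hsum : ∑ y ∈ A \ nb G A x, (((nb G A y).card : ℝ) - (nb G A x).card) ≤ s * n ^ 2 := by
          calc ∑ y ∈ A \ nb G A x, (((nb G A y).card : ℝ) - (nb G A x).card)
              ≤ ∑ y ∈ A \ nb G A x, (if y ∈ B then n else 0) := by
                apply Finset.sum_le_sum
                intro y hy
                rw [Finset.mem_sdiff] at hy
                split_ifs with hyB
                · have := hdeg y
                  have : (0 : ℝ) ≤ (nb G A x).card := Nat.cast_nonneg _
                  linarith
                · have := hmax y (Finset.mem_sdiff.2 ⟨hy.1, hyB⟩)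
                  have : ((nb G A y).card : ℝ) ≤ (nb G A x).card := Nat.cast_le.2 this
                  linarith
            _ ≤ ∑ y ∈ A, (if y ∈ B then n else 0) :=
                Finset.sum_le_sum_of_subset_of_nonneg Finset.sdiff_subset
                  (fun _ _ _ => by split_ifs <;> linarith)
            _ = B.card * n := by
                rw [← Finset.sum_filter, Finset.sum_const, nsmul_eq_mul]
                congr 3
                ext y
                simp only [hB, Finset.mem_filter]
                tauto
            _ ≤ s * n * n := mul_le_mul_of_nonneg_right hBc hn0.le
            _ = s * n ^ 2 := by ring
        have : s * n ^ 2 ≤ ε' / 4 * n ^ 2 := mul_le_mul_of_nonneg_right hs2 (by positivity)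
        linarith
    · refine ⟨fun _ => 0, by simp, ?_⟩
      have hAB : A ⊆ B := by
        rw [Finset.not_nonempty_iff_eq_empty, Finset.sdiff_eq_empty_iff_subset] at hg
        exact hg
      have hAc : (A.card : ℝ) ≤ s * n := le_trans (Nat.cast_le.2 (Finset.card_le_card hAB)) hBc
      have : exc G (fun _ => 0) A ≤ 2 * (A.card * n) := by
        simp only [exc, if_true]
        calc ∑ x ∈ A, ∑ y ∈ A, 2 * adjI G x y ≤ ∑ x ∈ A, 2 * n := by
              apply Finset.sum_le_sum; intro x _
              rw [← Finset.mul_sum, sum_adjI]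
              linarith [hdeg x]
          _ = _ := by rw [Finset.sum_const, nsmul_eq_mul]; ring
      have h3 : (A.card : ℝ) * n ≤ s * n * n := mul_le_mul_of_nonneg_right hAc hn0.le
      have : s * n ^ 2 ≤ ε' / 4 * n ^ 2 := mul_le_mul_of_nonneg_right hs2 (by positivity)
      have : 0 < ε' * n ^ 2 := by positivity
      nlinarith

theorem sum_cons {k : ℕ} {X : Type} [Fintype X] {M : Type} [AddCommMonoid M]
    (F : (Fin (k + 1) → X) → M) :
    ∑ x, F x = ∑ a, ∑ y : Fin k → X, F (Fin.cons a y) := by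
  rw [← Fintype.sum_prod_type' (f := fun a (y : Fin k → X) => F (Fin.cons a y))]
  exact (Fintype.sum_equiv (Fin.consEquiv fun _ => X) _ _ (fun _ => rfl)).symm

theorem prod_cons {k : ℕ} {X : Type} [Fintype X] {M : Type} [CommMonoid M]
    (F : (Fin (k + 1) → X) → M) :
    ∏ x, F x = ∏ a, ∏ y : Fin k → X, F (Fin.cons a y) := by
  rw [← Fintype.prod_prod_type' (f := fun a (y : Fin k → X) => F (Fin.cons a y))]
  exact (Fintype.prod_equiv (Fin.consEquiv fun _ => X) _ _ (fun _ => rfl)).symm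

/-- indicator of ordered cliques -/
noncomputable def clI {V : Type} (G : SimpleGraph V) (A : Finset V) {k : ℕ} (x : Fin k → V) : ℕ :=
  if (∀ i, x i ∈ A) ∧ ∀ i j, i < j → G.Adj (x i) (x j) then 1 else 0

theorem cnt_eq {V : Type} [Fintype V] (G : SimpleGraph V) (k : ℕ) : ∀ A : Finset V,
    cnt G k A = ∑ x : Fin k → V, clI G A x := by
  induction k with
  | zero => intro A; simp [cnt, clI]
  | succ k ih =>
    intro A
    rw [cnt, sum_cons]
    have : ∀ a : V, ∑ y : Fin k → V, clI G A (Fin.cons a y : Fin (k + 1) → V) =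
        if a ∈ A then cnt G k (nb G A a) else 0 := by
      intro a
      split_ifs with ha
      · rw [ih]
        apply Finset.sum_congr rfl
        intro y _
        unfold clI
        congr 1
        rw [eq_iff_iff]
        simp only [Fin.forall_fin_succ, Fin.cons_zero, Fin.cons_succ, nb, Finset.mem_filter,
          Fin.succ_lt_succ_iff, Fin.not_lt_zero, Fin.succ_pos]
        constructor
        · rintro ⟨⟨_, h1⟩, ⟨_, h2⟩, h3⟩
          exact ⟨fun i => ⟨h1 i, h2 i trivial⟩, fun i j h => (h3 i).2 j h⟩
        · rintro ⟨h1, h2⟩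
          exact ⟨⟨ha, fun i => (h1 i).1⟩, ⟨fun h => h.elim, fun i _ => (h1 i).2⟩,
            fun i => ⟨fun h => h.elim, fun j h => h2 i j h⟩⟩
      · apply Finset.sum_eq_zero
        intro y _
        unfold clI
        rw [if_neg]
        rintro ⟨h, -⟩
        exact ha (h 0)
    simp only [this]
    rw [← Finset.sum_filter]
    congr 1
    ext; simp

theorem jensen {ι : Type} [Fintype ι] [Nonempty ι] (g : ι → ℝ) (hg : ∀ i, 0 ≤ g i) (q : ℕ) :
    (Fintype.card ι : ℝ) * ((∑ i, g i) / Fintype.card ι) ^ q ≤ ∑ i, g i ^ q := by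
  have h0 : (0 : ℝ) < Fintype.card ι := Nat.cast_pos.2 Fintype.card_pos
  cases q with
  | zero => simp
  | succ q =>
    have := pow_sum_div_card_le_sum_pow (s := Finset.univ) (f := g) (fun i _ => hg i) q
    refine le_trans (le_of_eq ?_) this
    rw [Finset.card_univ, div_pow, pow_succ (Fintype.card ι : ℝ)]
    field_simp

theorem blowup {V β : Type} [Fintype V] [Nonempty V] [Fintype β] (k : ℕ) :
    ∀ F : (Fin k → V) → ℝ, (∀ x, 0 ≤ F x) →
    (Fintype.card V : ℝ) ^ (k * Fintype.card β) *
      ((∑ x, F x) / (Fintype.card V : ℝ) ^ k) ^ ((Fintype.card β) ^ k) ≤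
    ∑ y : Fin k → (β → V), ∏ j : Fin k → β, F (fun i => y i (j i)) := by
  have h0 : (0 : ℝ) < Fintype.card V := Nat.cast_pos.2 Fintype.card_pos
  induction k with
  | zero =>
    intro F hF
    simp only [Finset.univ_unique, Finset.sum_singleton, Finset.prod_singleton]
    simp only [zero_mul, pow_zero, pow_one, div_one, one_mul]
    apply le_of_eq
    congr 1
    ext i
    exact i.elim0
  | succ k ih =>
    intro F hF
    set n : ℝ := (Fintype.card V : ℝ) with hn
    set t := Fintype.card β with ht
    have e1 : ∑ y : Fin (k + 1) → (β → V), ∏ j : Fin (k + 1) → β, F (fun i => y i (j i)) =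
        ∑ y0 : β → V, ∑ y : Fin k → (β → V), ∏ j : Fin k → β,
          (fun x : Fin k → V => ∏ b, F (Fin.cons (y0 b) x)) (fun i => y i (j i)) := by
      rw [sum_cons]
      apply Finset.sum_congr rfl; intro y0 _
      apply Finset.sum_congr rfl; intro y _
      rw [prod_cons, Finset.prod_comm]
      apply Finset.prod_congr rfl; intro j _
      apply Finset.prod_congr rfl; intro b _
      congr 1
      ext i
      refine Fin.cases ?_ (fun i => ?_) i <;> simp
    rw [e1]
    have e2 : ∑ y0 : β → V, n ^ (k * t) *
        ((∑ x, (fun x : Fin k → V => ∏ b, F (Fin.cons (y0 b) x)) x) / n ^ k) ^ (t ^ k) ≤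
        ∑ y0 : β → V, ∑ y : Fin k → (β → V), ∏ j : Fin k → β,
          (fun x : Fin k → V => ∏ b, F (Fin.cons (y0 b) x)) (fun i => y i (j i)) :=
      Finset.sum_le_sum fun y0 _ => ih _ (fun x => Finset.prod_nonneg fun b _ => hF _)
    refine le_trans ?_ e2
    rw [← Finset.mul_sum]
    have e3 := jensen (ι := β → V)
      (fun y0 => (∑ x : Fin k → V, ∏ b, F (Fin.cons (y0 b) x)) / n ^ k)
      (fun y0 => div_nonneg (Finset.sum_nonneg fun x _ => Finset.prod_nonneg fun b _ => hF _)
        (by positivity)) (t ^ k)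
    refine le_trans ?_ (mul_le_mul_of_nonneg_left e3 (by positivity))
    have hc : (Fintype.card (β → V) : ℝ) = n ^ t := by
      rw [Fintype.card_fun]; push_cast; rfl
    rw [hc, ← mul_assoc, ← pow_add, show k * t + t = (k + 1) * t by ring, pow_succ' t k,
      pow_mul ((∑ x, F x) / n ^ (k + 1)) t (t ^ k)]
    apply mul_le_mul_of_nonneg_left _ (by positivity)
    have hS : 0 ≤ ∑ x, F x := Finset.sum_nonneg fun x _ => hF x
    apply pow_le_pow_left₀ (by positivity)
    rw [← Finset.sum_div, Finset.sum_comm]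
    have e4 : ∀ x : Fin k → V, ∑ y0 : β → V, ∏ b, F (Fin.cons (y0 b) x) =
        (∑ a, F (Fin.cons a x)) ^ t := by
      intro x
      have := Fintype.sum_pow (fun a => F (Fin.cons a x)) t
      rw [ht, ← Finset.card_univ, ← Finset.prod_const, Finset.prod_univ_sum]
      simp [Fintype.piFinset_univ]
    simp only [e4]
    have e5 := jensen (ι := Fin k → V) (fun x => ∑ a, F (Fin.cons a x))
      (fun x => Finset.sum_nonneg fun _ _ => hF _) t
    have hc' : (Fintype.card (Fin k → V) : ℝ) = n ^ k := by
      rw [Fintype.card_fun, Fintype.card_fin]; push_cast; rfl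
    rw [hc', Finset.sum_comm, ← sum_cons] at e5
    calc ((∑ x, F x) / n ^ (k + 1)) ^ t
        = n ^ k * ((∑ x, F x) / n ^ k) ^ t / n ^ k / n ^ t := by
          rw [div_pow, div_pow, pow_succ, mul_pow]
          field_simp
      _ ≤ _ := by gcongr

noncomputable def homs {α V : Type} [Fintype α] [Fintype V] (H : SimpleGraph α)
    (G : SimpleGraph V) : Finset (α → V) :=
  Finset.univ.filter fun φ => ∀ a b, H.Adj a b → G.Adj (φ a) (φ b)

theorem mem_homs {α V : Type} [Fintype α] [Fintype V] (H : SimpleGraph α)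
    (G : SimpleGraph V) (φ : α → V) :
    φ ∈ homs H G ↔ ∀ a b, H.Adj a b → G.Adj (φ a) (φ b) := by
  rw [homs, Finset.mem_filter]
  exact and_iff_right (Finset.mem_univ _)

theorem homs_ge {α V : Type} [Fintype α] [Fintype V] [Nonempty V] (H : SimpleGraph α)
    (G : SimpleGraph V) (q : ℕ) (c : α → Fin (q + 1)) (hc : ∀ a b, H.Adj a b → c a ≠ c b) :
    (Fintype.card V : ℝ) ^ (Fintype.card α) * ((cnt G (q + 1) Finset.univ : ℝ) /
      (Fintype.card V : ℝ) ^ (q + 1)) ^ ((Fintype.card α) ^ (q + 1)) ≤ (homs H G).card := by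
  have h0 : (0 : ℝ) < Fintype.card V := Nat.cast_pos.2 Fintype.card_pos
  have hb := blowup (β := α) (q + 1) (fun x : Fin (q + 1) → V => (clI G Finset.univ x : ℝ))
    (fun _ => Nat.cast_nonneg _)
  rw [← Nat.cast_sum, ← cnt_eq] at hb
  set t := Fintype.card α with ht
  set n : ℝ := (Fintype.card V : ℝ) with hn
  -- the maps giving homs
  set Y : Finset (Fin (q + 1) → (α → V)) := Finset.univ.filter fun y =>
    (fun a => y (c a) a) ∈ homs H G with hY
  have h1 : ∑ y : Fin (q + 1) → (α → V), ∏ j : Fin (q + 1) → α,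
      (clI G Finset.univ (fun i => y i (j i)) : ℝ) ≤ Y.card := by
    rw [hY, Finset.card_filter, Nat.cast_sum]
    apply Finset.sum_le_sum
    intro y _
    by_cases hall : ∀ j : Fin (q + 1) → α, clI G Finset.univ (fun i => y i (j i)) = 1
    · have : (fun a => y (c a) a) ∈ homs H G := by
        rw [homs, Finset.mem_filter]
        refine ⟨Finset.mem_univ _, fun a b hab => ?_⟩
        have hne := hc a b hab
        have hj := hall (fun i => if i = c a then a else b)
        unfold clI at hj
        have hj' := (ite_eq_left_iff.1 hj)
        have hj2 : ∀ i j : Fin (q + 1), i < j → G.Adj (y i (if i = c a then a else b))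
            (y j (if j = c a then a else b)) := by
          by_contra hcon
          have := hj' (fun h => hcon h.2)
          omega
        rcases lt_or_gt_of_ne hne with hlt | hlt
        · have := hj2 _ _ hlt
          rwa [if_pos rfl, if_neg hne.symm] at this
        · have := hj2 _ _ hlt
          rw [if_pos rfl, if_neg hne.symm] at this
          exact this.symm
      rw [if_pos this]
      simp [hall]
    · push Not at hall
      obtain ⟨j, hj⟩ := hall
      have : clI G Finset.univ (fun i => y i (j i)) = 0 := by
        unfold clI at hj ⊢
        split_ifs at hj ⊢ <;> tauto
      rw [Finset.prod_eq_zero (Finset.mem_univ j) (by rw [this]; simp)]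
      exact Nat.cast_nonneg _
  have h2 : (Y.card : ℝ) ≤ (homs H G).card * n ^ (q * t) := by
    have hsub : Y ⊆ (homs H G).biUnion fun φ => Fintype.piFinset fun i =>
        Fintype.piFinset fun a => if i = c a then {φ a} else Finset.univ := by
      intro y hy
      rw [hY, Finset.mem_filter] at hy
      rw [Finset.mem_biUnion]
      refine ⟨_, hy.2, ?_⟩
      rw [Fintype.mem_piFinset]
      intro i
      rw [Fintype.mem_piFinset]
      intro a
      split_ifs with h
      · rw [h]; simp
      · simp
    have := (Finset.card_le_card hsub).trans (Finset.card_biUnion_le_card_mul _ _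
      ((Fintype.card V) ^ (q * t)) (by
        intro φ _
        apply le_of_eq
        rw [Fintype.card_piFinset]
        simp only [Fintype.card_piFinset]
        rw [Finset.prod_comm]
        have : ∀ a : α, ∏ i : Fin (q + 1), (if i = c a then {φ a} else
            (Finset.univ : Finset V)).card = (Fintype.card V) ^ q := by
          intro a
          have : ∀ i : Fin (q + 1), (if i = c a then {φ a} else
            (Finset.univ : Finset V)).card = if i = c a then 1 else Fintype.card V := by
            intro i; split_ifs <;> simp
          simp only [this]
          rw [Finset.prod_ite]
          simp [Finset.filter_ne']
        simp only [this]
        rw [Finset.prod_const, ← pow_mul, Finset.card_univ]))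
    rw [hn]
    exact_mod_cast this
  have h3 := hb.trans (h1.trans h2)
  rw [show (q + 1) * t = t + q * t by ring, pow_add, mul_right_comm] at h3
  exact le_of_mul_le_mul_right h3 (by positivity)

/-- monochromatic pairs -/
noncomputable def monoE {V : Type} (Γ : Finset (Sym2 V)) (c : V → ℕ) : Finset (Sym2 V) :=
  Γ.filter fun e => (Sym2.map c e).IsDiag

theorem sum_adj_fromEdgeSet {V : Type} [Fintype V] (Γ : Finset (Sym2 V))
    (hΓ : ∀ e ∈ Γ, ¬ e.IsDiag) :
    ∑ x, ∑ y, adjI (SimpleGraph.fromEdgeSet (Γ : Set (Sym2 V))) x y = 2 * (Γ.card : ℝ) := by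
  have h1 : (SimpleGraph.fromEdgeSet (Γ : Set (Sym2 V))).edgeFinset = Γ := by
    ext e
    rw [SimpleGraph.mem_edgeFinset, SimpleGraph.edgeSet_fromEdgeSet]
    simp only [Set.mem_sdiff, Finset.mem_coe]
    constructor
    · exact fun h => h.1
    · exact fun h => ⟨h, hΓ e h⟩
  have h := (SimpleGraph.fromEdgeSet (Γ : Set (Sym2 V))).sum_degrees_eq_twice_card_edges
  have h1' : (SimpleGraph.fromEdgeSet (Γ : Set (Sym2 V))).edgeFinset.card = Γ.card := by
    rw [← congrArg Finset.card h1]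
  have h' : _ = 2 * Γ.card := h.trans (by
    rw [← h1']
    congr! 2
    ext e
    simp only [SimpleGraph.mem_edgeFinset])
  have h2 : (∑ x, (SimpleGraph.fromEdgeSet (Γ : Set (Sym2 V))).degree x : ℝ) = 2 * (Γ.card : ℝ) := by
    exact_mod_cast h'
  rw [← h2]
  apply Finset.sum_congr rfl
  intro x _
  rw [sum_adjI, ← SimpleGraph.card_neighborFinset_eq_degree]
  congr 2
  ext y
  simp [nb]

theorem adjI_mono {V : Type} (Γ : Finset (Sym2 V)) (c : V → ℕ) (x y : V) :
    adjI (SimpleGraph.fromEdgeSet (monoE Γ c : Set (Sym2 V))) x y =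
      if c x = c y then adjI (SimpleGraph.fromEdgeSet (Γ : Set (Sym2 V))) x y else 0 := by
  unfold adjI
  simp only [SimpleGraph.fromEdgeSet_adj, monoE, Finset.coe_filter, Set.mem_ofPred_eq, Sym2.map_mk,
    Sym2.mk_isDiag_iff, Finset.mem_coe]
  by_cases h : c x = c y <;> simp [h]

theorem sum_same {V : Type} [Fintype V] (c : V → ℕ) (r : ℕ) (hc : ∀ x, c x < r + 1) :
    (Fintype.card V : ℝ) ^ 2 / (r + 1) ≤ ∑ x, ∑ y, (if c x = c y then (1 : ℝ) else 0) := by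
  have h1 : ∑ x, ∑ y, (if c x = c y then (1 : ℝ) else 0) =
      ∑ j ∈ Finset.range (r + 1), (∑ x, if c x = j then (1 : ℝ) else 0) ^ 2 := by
    simp only [sq, Finset.sum_mul_sum]
    rw [Finset.sum_comm (s := Finset.range (r + 1))]
    apply Finset.sum_congr rfl; intro x _
    rw [Finset.sum_comm (s := Finset.range (r + 1))]
    apply Finset.sum_congr rfl; intro y _
    have : ∀ j, (if c x = j then (1 : ℝ) else 0) * (if c y = j then 1 else 0) =
        if c x = j then (if c x = c y then 1 else 0) else 0 := by
      intro j
      by_cases h : c x = j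
      · subst h; simp [eq_comm]
      · simp [h]
    simp only [this]
    rw [Finset.sum_ite_eq]
    simp [hc x]
  rw [h1]
  have h2 := sq_sum_le_card_mul_sum_sq (s := Finset.range (r + 1))
    (f := fun j => ∑ x, if c x = j then (1 : ℝ) else 0)
  have h3 : ∑ j ∈ Finset.range (r + 1), ∑ x, (if c x = j then (1 : ℝ) else 0) =
      Fintype.card V := by
    rw [Finset.sum_comm]
    have : ∀ x, ∑ j ∈ Finset.range (r + 1), (if c x = j then (1 : ℝ) else 0) = 1 := by
      intro x
      rw [Finset.sum_ite_eq]
      simp [hc x]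
    simp [this]
  rw [h3, Finset.card_range] at h2
  rw [div_le_iff₀ (by positivity)]
  push_cast at h2
  linarith

theorem exc_univ {V : Type} [Fintype V] (Γ : Finset (Sym2 V)) (hΓ : ∀ e ∈ Γ, ¬ e.IsDiag)
    (c : V → ℕ) (r : ℕ) (hc : ∀ x, c x < r + 1) :
    2 * (Γ.card : ℝ) + 2 * (monoE Γ c).card ≤
      exc (SimpleGraph.fromEdgeSet (Γ : Set (Sym2 V))) c Finset.univ +
      (1 - 1 / ((r : ℝ) + 1)) * (Fintype.card V : ℝ) ^ 2 := by
  have h1 := sum_adj_fromEdgeSet Γ hΓ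
  have h2 := sum_adj_fromEdgeSet (monoE Γ c) (fun e he => hΓ e (Finset.filter_subset _ _ he))
  have h3 := sum_same c r hc
  have h4 : exc (SimpleGraph.fromEdgeSet (Γ : Set (Sym2 V))) c Finset.univ =
      ∑ x, ∑ y, adjI (SimpleGraph.fromEdgeSet (Γ : Set (Sym2 V))) x y +
      ∑ x, ∑ y, adjI (SimpleGraph.fromEdgeSet (monoE Γ c : Set (Sym2 V))) x y -
      ((Fintype.card V : ℝ) ^ 2 - ∑ x, ∑ y, (if c x = c y then (1 : ℝ) else 0)) := by
    have h5 : (Fintype.card V : ℝ) ^ 2 = ∑ x : V, ∑ y : V, (1 : ℝ) := by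
      simp [sq]
    rw [h5]
    unfold exc
    simp only [← Finset.sum_add_distrib, ← Finset.sum_sub_distrib]
    apply Finset.sum_congr rfl; intro x _
    apply Finset.sum_congr rfl; intro y _
    rw [adjI_mono]
    split_ifs <;> ring
  rw [h4, h1, h2]
  have h6 : (1 - 1 / ((r : ℝ) + 1)) * (Fintype.card V : ℝ) ^ 2 =
    (Fintype.card V : ℝ) ^ 2 - (Fintype.card V : ℝ) ^ 2 / (r + 1) := by ring
  rw [h6]
  linarith

theorem cp_subset_iff {α V : Type} [Fintype α] (H : SimpleGraph α) (Γ : Finset (Sym2 V))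
    (φ : α → V) : cp H φ ⊆ Γ ↔ ∀ a b, H.Adj a b → s(φ a, φ b) ∈ Γ := by
  constructor
  · intro h a b hab
    exact h ((mem_cp H φ _).2 ⟨s(a, b), by simpa using hab, rfl⟩)
  · intro h x hx
    obtain ⟨e, he, rfl⟩ := (mem_cp H φ _).1 hx
    induction e with
    | h a b =>
      rw [SimpleGraph.mem_edgeFinset, SimpleGraph.mem_edgeSet] at he
      exact h a b he

theorem struct {α : Type} [Fintype α] (H : SimpleGraph α) (r : ℕ) (hH : H.Colorable (r + 2))
    (ε' : ℝ) (hε' : 0 < ε') : ∃ ε₂ : ℝ, 0 < ε₂ ∧ ∃ n₀ : ℕ, ∀ n : ℕ, n₀ ≤ n →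
      ∀ Γ : Finset (Sym2 (Fin n)), (∀ e ∈ Γ, ¬ e.IsDiag) →
      (((injs α n).filter fun φ => cp H φ ⊆ Γ).card : ℝ) ≤ ε₂ * (injs α n).card →
      ∃ c : Fin n → ℕ, (∀ x, c x < r + 1) ∧
        2 * (Γ.card : ℝ) + 2 * (monoE Γ c).card ≤
          (1 - 1 / ((r : ℝ) + 1)) * (n : ℝ) ^ 2 + ε' * (n : ℝ) ^ 2 := by
  obtain ⟨ε, hε, hst⟩ := stability r ε' hε'
  obtain ⟨col⟩ := hH
  set v := Fintype.card α with hv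
  set ε₂ : ℝ := ε ^ (v ^ (r + 2)) / 2 with hε₂
  have hε₂0 : 0 < ε₂ := by positivity
  obtain ⟨n1, hn1⟩ := exists_nat_gt ((v : ℝ) ^ 2 / ε₂)
  refine ⟨ε₂, hε₂0, max n1 (v + 1), ?_⟩
  intro n hn Γ hΓ hcnt
  have hnv : v + 1 ≤ n := le_trans (le_max_right _ _) hn
  have hn0 : 0 < n := by omega
  have hn0' : (0 : ℝ) < n := by exact_mod_cast hn0
  have hnn1 : (n1 : ℝ) ≤ n := by exact_mod_cast le_trans (le_max_left _ _) hn
  have : Nonempty (Fin n) := ⟨⟨0, hn0⟩⟩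
  have hsmall : (v : ℝ) ^ 2 / n < ε₂ := by
    rw [div_lt_iff₀ hn0']
    rw [div_lt_iff₀ hε₂0] at hn1
    nlinarith
  set G := SimpleGraph.fromEdgeSet (Γ : Set (Sym2 (Fin n))) with hG
  by_cases hc : (cnt G (r + 2) Finset.univ : ℝ) ≤
      ε * (Fintype.card (Fin n) : ℝ) ^ (r + 2)
  · obtain ⟨c, hc1, hc2⟩ := hst (Fin n) G Finset.univ hc
    refine ⟨c, hc1, ?_⟩
    have := exc_univ Γ hΓ c r hc1
    rw [Fintype.card_fin] at this hc2
    linarith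
  · exfalso
    push Not at hc
    have hh := homs_ge H G (r + 1) col (fun a b hab => col.valid hab)
    rw [Fintype.card_fin] at hh hc
    have h1 : ε ≤ (cnt G (r + 2) Finset.univ : ℝ) / (n : ℝ) ^ (r + 2) := by
      rw [le_div_iff₀ (by positivity)]; exact hc.le
    have h2 : (n : ℝ) ^ v * (2 * ε₂) ≤ (homs H G).card := by
      refine le_trans ?_ hh
      rw [hε₂, mul_div_cancel₀ _ (two_ne_zero)]
      apply mul_le_mul_of_nonneg_left _ (by positivity)
      exact pow_le_pow_left₀ hε.le h1 _
    have h3 : homs H G ⊆ ((injs α n).filter fun φ => cp H φ ⊆ Γ) ∪ (injs α n)ᶜ := by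
      intro φ hφ
      rw [mem_homs] at hφ
      rw [Finset.mem_union]
      by_cases hi : φ ∈ injs α n
      · left
        rw [Finset.mem_filter]
        refine ⟨hi, (cp_subset_iff H Γ φ).2 fun a b hab => ?_⟩
        have := hφ a b hab
        rw [hG, SimpleGraph.fromEdgeSet_adj] at this
        exact this.1
      · right
        exact Finset.mem_compl.2 hi
    have h4 := (Finset.card_le_card h3).trans (Finset.card_union_le _ _)
    have hcu : (injs α n).card ≤ n ^ v := by
      refine (Finset.card_le_univ _).trans (le_of_eq ?_)
      rw [Fintype.card_fun, Fintype.card_fin]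
    rw [Finset.card_compl, Fintype.card_fun, Fintype.card_fin] at h4
    have h5 : ((homs H G).card : ℝ) ≤ ((injs α n).filter fun φ => cp H φ ⊆ Γ).card +
        ((n : ℝ) ^ v - (injs α n).card) := by
      have : ((homs H G).card : ℝ) ≤ ((injs α n).filter fun φ => cp H φ ⊆ Γ).card +
        ((n ^ v - (injs α n).card : ℕ) : ℝ) := by exact_mod_cast h4
      rw [Nat.cast_sub hcu] at this
      push_cast at this
      exact this
    have h6 := card_injs_ge α n hn0 (by omega)
    have hcu' : ((injs α n).card : ℝ) ≤ (n : ℝ) ^ v := by exact_mod_cast hcu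
    have h7 : (0 : ℝ) < (n : ℝ) ^ v := by positivity
    have h8 : (n : ℝ) ^ v * ((v : ℝ) ^ 2 / n) < (n : ℝ) ^ v * ε₂ := mul_lt_mul_of_pos_left hsmall h7
    have h9 : ε₂ * (injs α n).card ≤ ε₂ * (n : ℝ) ^ v := mul_le_mul_of_nonneg_left hcu' hε₂0.le
    rw [← hv] at h6
    nlinarith

theorem doubling {X : Type} (Γ B : Finset X) (k s : ℕ) :
    ((Γ.powersetCard k).filter fun F => s ≤ (F ∩ B).card).card * 2 ^ s ≤
      (Γ.card + B.card).choose k := by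
  set A := (Γ.powersetCard k).filter fun F => s ≤ (F ∩ B).card with hA
  have h1 : A.card * 2 ^ s ≤ ∑ F ∈ A, ((F ∩ B).powerset).card := by
    rw [← smul_eq_mul, ← Finset.sum_const]
    apply Finset.sum_le_sum
    intro F hF
    rw [Finset.card_powerset]
    exact Nat.pow_le_pow_right (by norm_num) (Finset.mem_filter.1 hF).2
  refine h1.trans ?_
  rw [← Finset.card_sigma, ← Finset.card_disjSum, ← Finset.card_powersetCard]
  apply Finset.card_le_card_of_injOn (fun x => (x.1 \ x.2).disjSum x.2)
  · rintro ⟨F, U⟩ hx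
    rw [Finset.mem_coe, Finset.mem_sigma] at hx
    obtain ⟨hF, hU⟩ := hx
    dsimp only at hF hU ⊢
    rw [Finset.mem_powerset] at hU
    have hF' := Finset.mem_powersetCard.1 (Finset.mem_filter.1 hF).1
    rw [Finset.mem_coe, Finset.mem_powersetCard]
    have hUF : U ⊆ F := hU.trans Finset.inter_subset_left
    constructor
    · exact Finset.disjSum_mono (Finset.sdiff_subset.trans hF'.1)
        (hU.trans Finset.inter_subset_right)
    · rw [Finset.card_disjSum, Finset.card_sdiff_add_card_eq_card hUF, hF'.2]
  · rintro ⟨F, U⟩ hx ⟨F', U'⟩ hx' heq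
    rw [Finset.mem_coe, Finset.mem_sigma] at hx hx'
    have hU := Finset.mem_powerset.1 hx.2
    have hU' := Finset.mem_powerset.1 hx'.2
    dsimp only at heq hU hU'
    have e2 : U = U' := by
      ext z
      have := congrArg (fun S => Sum.inr z ∈ S) heq
      simpa using this
    have e1 : F \ U = F' \ U' := by
      ext z
      have := congrArg (fun S => Sum.inl z ∈ S) heq
      simpa using this
    have hUF : U ⊆ F := hU.trans Finset.inter_subset_left
    have hUF' : U' ⊆ F' := hU'.trans Finset.inter_subset_left
    have e3 : F = F' := by
      rw [← Finset.sdiff_union_of_subset hUF, ← Finset.sdiff_union_of_subset hUF', e1, e2]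
    subst e2 e3
    rfl

theorem choose_shift (Q m : ℕ) (hQ : m ≤ Q) (t : ℕ) (ht : t ≤ m) :
    (Q.choose (m - t) : ℝ) * ((Q : ℝ) - m) ^ t ≤ Q.choose m * (m : ℝ) ^ t := by
  have hQm : (0 : ℝ) ≤ (Q : ℝ) - m := by
    have : (m : ℝ) ≤ Q := by exact_mod_cast hQ
    linarith
  induction t with
  | zero => simp
  | succ t ih =>
    have ih' := ih (by omega)
    obtain ⟨k, hk⟩ : ∃ k, m - t = k + 1 := ⟨m - t - 1, by omega⟩
    have hk' : m - (t + 1) = k := by omega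
    rw [hk] at ih'
    rw [hk']
    have h1 := Nat.choose_succ_right_eq Q k
    have h2 : (Q.choose (k + 1) : ℝ) * (k + 1) = Q.choose k * ((Q : ℝ) - k) := by
      rw [← Nat.cast_sub (by omega)]
      exact_mod_cast h1
    have hkm : ((k : ℝ) + 1) ≤ m := by
      have : k + 1 ≤ m := by omega
      exact_mod_cast this
    have h3 : (Q.choose k : ℝ) * ((Q : ℝ) - m) ≤ Q.choose (k + 1) * m := by
      calc (Q.choose k : ℝ) * ((Q : ℝ) - m) ≤ Q.choose k * ((Q : ℝ) - k) :=
            mul_le_mul_of_nonneg_left (by linarith) (by positivity)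
        _ = Q.choose (k + 1) * (k + 1) := h2.symm
        _ ≤ _ := mul_le_mul_of_nonneg_left hkm (by positivity)
    calc (Q.choose k : ℝ) * ((Q : ℝ) - m) ^ (t + 1)
        = (Q.choose k * ((Q : ℝ) - m)) * ((Q : ℝ) - m) ^ t := by ring
      _ ≤ (Q.choose (k + 1) * m) * ((Q : ℝ) - m) ^ t :=
          mul_le_mul_of_nonneg_right h3 (by positivity)
      _ = m * (Q.choose (k + 1) * ((Q : ℝ) - m) ^ t) := by ring
      _ ≤ m * (Q.choose m * (m : ℝ) ^ t) := mul_le_mul_of_nonneg_left ih' (by positivity)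
      _ = _ := by ring

theorem choose_ratio (q m : ℕ) (hq : m < q) (d : ℕ) :
    ((q + d).choose m : ℝ) ≤ q.choose m * Real.exp (d * (m / ((q : ℝ) - m))) := by
  have hqm : (0 : ℝ) < (q : ℝ) - m := by
    have : (m : ℝ) < q := by exact_mod_cast hq
    linarith
  induction d with
  | zero => simp
  | succ d ih =>
    have h1 := Nat.choose_mul_succ_eq (q + d) m
    have h2 : ((q + d).choose m : ℝ) * ((q : ℝ) + d + 1) =
        (q + (d + 1)).choose m * ((q : ℝ) + d + 1 - m) := by
      have h3 : (((q + d + 1 - m : ℕ)) : ℝ) = (q : ℝ) + d + 1 - m := by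
        rw [Nat.cast_sub (by omega)]; push_cast; ring
      rw [← h3]
      exact_mod_cast h1
    have hpos : (0 : ℝ) < (q : ℝ) + d + 1 - m := by
      have : (0 : ℝ) ≤ d := by positivity
      linarith
    have h4 : ((q + (d + 1)).choose m : ℝ) = (q + d).choose m *
        (m / ((q : ℝ) + d + 1 - m) + 1) := by
      field_simp
      linarith
    have h5 : (m : ℝ) / ((q : ℝ) + d + 1 - m) + 1 ≤ Real.exp (m / ((q : ℝ) - m)) := by
      refine le_trans ?_ (Real.add_one_le_exp _)
      gcongr
      have : (0 : ℝ) ≤ d := by positivity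
      linarith
    rw [h4]
    calc ((q + d).choose m : ℝ) * (m / ((q : ℝ) + d + 1 - m) + 1)
        ≤ (q.choose m * Real.exp (d * (m / ((q : ℝ) - m)))) * Real.exp (m / ((q : ℝ) - m)) :=
          mul_le_mul ih h5 (by positivity) (by positivity)
      _ = _ := by
          rw [mul_assoc, ← Real.exp_add]
          congr 2
          push_cast
          ring

theorem sum_choose_bound (N Q m τ : ℕ) (hQ : m < Q) (hτ : τ ≤ m) (θ y : ℝ) (hθ : 0 < θ)
    (hθ1 : θ ≤ 1) (hy : (N : ℝ) * m / ((Q : ℝ) - m) ≤ y) :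
    ∑ t ∈ Finset.range (τ + 1), ((N.choose t : ℝ) * Q.choose (m - t)) ≤
      Q.choose m * ((θ⁻¹) ^ τ * Real.exp (θ * y)) := by
  have hQm : (0 : ℝ) < (Q : ℝ) - m := by
    have : (m : ℝ) < Q := by exact_mod_cast hQ
    linarith
  have hy0 : 0 ≤ y := le_trans (by positivity) hy
  have h1 : ∀ t ∈ Finset.range (τ + 1), ((N.choose t : ℝ) * Q.choose (m - t)) ≤
      Q.choose m * ((θ⁻¹) ^ τ * ((θ * y) ^ t / t.factorial)) := by
    intro t ht
    rw [Finset.mem_range] at ht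
    have hs := choose_shift Q m hQ.le t (by omega)
    have hs' : (Q.choose (m - t) : ℝ) ≤ Q.choose m * (m / ((Q : ℝ) - m)) ^ t := by
      rw [div_pow, ← mul_div_assoc, le_div_iff₀ (by positivity)]
      exact hs
    have hN : (N.choose t : ℝ) ≤ (N : ℝ) ^ t / t.factorial := Nat.choose_le_pow_div t N
    have hθt : 1 ≤ (θ⁻¹) ^ τ * θ ^ t := by
      have : θ ^ τ ≤ θ ^ t := pow_le_pow_of_le_one hθ.le hθ1 (by omega)
      rw [inv_pow, inv_mul_eq_div, le_div_iff₀ (by positivity)]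
      linarith
    calc ((N.choose t : ℝ) * Q.choose (m - t))
        ≤ ((N : ℝ) ^ t / t.factorial) * (Q.choose m * (m / ((Q : ℝ) - m)) ^ t) :=
          mul_le_mul hN hs' (by positivity) (by positivity)
      _ = Q.choose m * ((N * m / ((Q : ℝ) - m)) ^ t / t.factorial) := by
          rw [mul_div_assoc, mul_pow]; ring
      _ ≤ Q.choose m * (y ^ t / t.factorial) := by gcongr
      _ ≤ Q.choose m * (((θ⁻¹) ^ τ * θ ^ t) * (y ^ t / t.factorial)) := by
          apply mul_le_mul_of_nonneg_left _ (by positivity)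
          exact le_mul_of_one_le_left (by positivity) hθt
      _ = _ := by rw [mul_pow]; ring
  refine (Finset.sum_le_sum h1).trans ?_
  rw [← Finset.mul_sum, ← Finset.mul_sum]
  have := Real.sum_le_exp_of_nonneg (x := θ * y) (by positivity) (τ + 1)
  gcongr

/-- non-diagonal pairs -/
noncomputable def ND (n : ℕ) : Finset (Sym2 (Fin n)) :=
  Finset.univ.filter fun e : Sym2 (Fin n) => ¬ e.IsDiag

/-- edges of the balanced multipartite graph -/
noncomputable def turE (n R : ℕ) : Finset (Sym2 (Fin n)) :=
  Finset.univ.filter fun e : Sym2 (Fin n) => ¬ (Sym2.map (fun x : Fin n => (x : ℕ) % R) e).IsDiag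

theorem mem_turE (n R : ℕ) (e : Sym2 (Fin n)) :
    e ∈ turE n R ↔ ¬ (Sym2.map (fun x : Fin n => (x : ℕ) % R) e).IsDiag := by
  rw [turE, Finset.mem_filter]
  exact and_iff_right (Finset.mem_univ _)

theorem mem_ND (n : ℕ) (e : Sym2 (Fin n)) : e ∈ ND n ↔ ¬ e.IsDiag := by
  rw [ND, Finset.mem_filter]
  exact and_iff_right (Finset.mem_univ _)

theorem turE_sub (n R : ℕ) : turE n R ⊆ ND n := by
  intro e he
  rw [mem_turE] at he
  rw [mem_ND]
  induction e with
  | h a b =>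
    simp only [Sym2.map_mk, Sym2.mk_isDiag_iff] at he ⊢
    intro h
    exact he (by rw [h])

theorem card_turE (n r : ℕ) :
    (1 - 1 / ((r : ℝ) + 1)) * (n : ℝ) ^ 2 - n ≤ 2 * ((turE n (r + 1)).card : ℝ) := by
  rw [← sum_adj_fromEdgeSet _ (fun e he => (mem_ND n e).1 (turE_sub n (r + 1) he))]
  have h1 : ∀ x : Fin n, (n : ℝ) - ((n : ℝ) / (r + 1) + 1) ≤ ∑ y, adjI (SimpleGraph.fromEdgeSet
      ((turE n (r + 1) : Finset (Sym2 (Fin n))) : Set (Sym2 (Fin n)))) x y := by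
    intro x
    have h2 : ∀ y : Fin n, 1 - (if (y : ℕ) % (r + 1) = (x : ℕ) % (r + 1) then (1 : ℝ) else 0) ≤
        adjI (SimpleGraph.fromEdgeSet
      ((turE n (r + 1) : Finset (Sym2 (Fin n))) : Set (Sym2 (Fin n)))) x y := by
      intro y
      split_ifs with h
      · simpa using adjI_nonneg _ _ _
      · unfold adjI
        rw [if_pos]
        · simp
        · rw [SimpleGraph.fromEdgeSet_adj, Finset.mem_coe, mem_turE]
          constructor
          · simp only [Sym2.map_mk, Sym2.mk_isDiag_iff]
            exact fun hh => h hh.symm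
          · rintro rfl
            exact h rfl
    refine le_trans ?_ (Finset.sum_le_sum fun y _ => h2 y)
    rw [Finset.sum_sub_distrib, Finset.sum_boole]
    have h3 : (Finset.univ.filter fun y : Fin n => (y : ℕ) % (r + 1) = (x : ℕ) % (r + 1)).card
        ≤ n / (r + 1) + 1 := by
      conv_rhs => rw [← Finset.card_range (n / (r + 1) + 1)]
      apply Finset.card_le_card_of_injOn (fun y : Fin n => (y : ℕ) / (r + 1))
      · intro y _
        rw [Finset.mem_coe, Finset.mem_range]
        have := Nat.div_le_div_right (c := r + 1) y.2.le
        dsimp only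
        omega
      · intro y hy z hz hyz
        rw [Finset.mem_coe, Finset.mem_filter] at hy hz
        have e1 := Nat.div_add_mod (y : ℕ) (r + 1)
        have e2 := Nat.div_add_mod (z : ℕ) (r + 1)
        dsimp only at hyz
        rw [hy.2, hyz] at e1
        rw [hz.2] at e2
        exact Fin.ext (by omega)
    have h4 : ((Finset.univ.filter fun y : Fin n => (y : ℕ) % (r + 1) = (x : ℕ) % (r + 1)).card : ℝ)
        ≤ (n : ℝ) / (r + 1) + 1 := by
      refine le_trans (Nat.cast_le.2 h3) ?_
      push_cast
      have := @Nat.cast_div_le ℝ _ _ _ n (r + 1)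
      push_cast at this
      linarith
    simp only [Finset.sum_const, Finset.card_univ, Fintype.card_fin, nsmul_eq_mul, mul_one]
    linarith
  have h5 := Finset.sum_le_sum (s := Finset.univ) fun x _ => h1 x
  refine le_trans (le_of_eq ?_) h5
  rw [Finset.sum_const, Finset.card_univ, Fintype.card_fin, nsmul_eq_mul]
  ring

theorem union_bound {X : Type} [Fintype X] (m τ Q w : ℕ) (s : Scheme X (Finset X))
    (Γ B : Finset X → Finset X) (Bad : Finset (Finset X))
    (h : ∀ G ∈ Bad, G.card = m ∧ (s.sel G).card ≤ τ ∧ G ⊆ Γ (s.out G) ∧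
      (Γ (s.out G)).card + (B (s.out G)).card ≤ Q ∧ w + τ ≤ (G ∩ B (s.out G)).card) :
    Bad.card * 2 ^ w ≤
      ∑ t ∈ Finset.range (τ + 1), (Fintype.card X).choose t * Q.choose (m - t) := by
  have h1 : Bad ⊆ (Finset.range (τ + 1)).biUnion fun t =>
      ((Finset.univ : Finset X).powersetCard t).biUnion fun T => Bad.filter fun G => s.sel G = T := by
    intro G hG
    have := h G hG
    rw [Finset.mem_biUnion]
    refine ⟨(s.sel G).card, by rw [Finset.mem_range]; omega, ?_⟩
    rw [Finset.mem_biUnion]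
    refine ⟨s.sel G, by rw [Finset.mem_powersetCard]; exact ⟨Finset.subset_univ _, rfl⟩, ?_⟩
    rw [Finset.mem_filter]
    exact ⟨hG, rfl⟩
  have hfib : ∀ t ∈ Finset.range (τ + 1), ∀ T ∈ (Finset.univ : Finset X).powersetCard t,
      (Bad.filter fun G => s.sel G = T).card * 2 ^ w ≤ Q.choose (m - t) := by
    intro t ht T hT
    rw [Finset.mem_powersetCard] at hT
    rw [Finset.mem_range] at ht
    rcases (Bad.filter fun G => s.sel G = T).eq_empty_or_nonempty with he | ⟨G0, hG0⟩
    · rw [he]; simp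
    have hout : ∀ G ∈ Bad.filter fun G => s.sel G = T, T ⊆ G ∧ s.out G = s.out T := by
      intro G hG
      rw [Finset.mem_filter] at hG
      have hs := s.sub G
      rw [hG.2] at hs
      exact ⟨hs, (s.cons G T (by rw [hG.2]) hs).2.symm⟩
    have hQ : (Γ (s.out T)).card + (B (s.out T)).card ≤ Q := by
      have := (h G0 (Finset.mem_filter.1 hG0).1).2.2.2.1
      rwa [(hout G0 hG0).2] at this
    have hle : (Bad.filter fun G => s.sel G = T).card ≤
        (((Γ (s.out T)).powersetCard (m - t)).filter fun F =>
          w ≤ (F ∩ B (s.out T)).card).card := by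
      apply Finset.card_le_card_of_injOn (fun G => G \ T)
      · intro G hG
        rw [Finset.mem_coe] at hG
        obtain ⟨hTG, ho⟩ := hout G hG
        obtain ⟨g1, g2, g3, g4, g5⟩ := h G (Finset.mem_filter.1 hG).1
        rw [ho] at g3 g4 g5
        rw [Finset.mem_coe, Finset.mem_filter, Finset.mem_powersetCard]
        refine ⟨⟨Finset.sdiff_subset.trans g3, ?_⟩, ?_⟩
        · rw [Finset.card_sdiff_of_subset hTG, g1, hT.2]
        · have hsub : G ∩ B (s.out T) ⊆ ((G \ T) ∩ B (s.out T)) ∪ T := by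
            intro x hx
            rw [Finset.mem_inter] at hx
            simp only [Finset.mem_union, Finset.mem_inter, Finset.mem_sdiff]
            tauto
          have := (Finset.card_le_card hsub).trans (Finset.card_union_le _ _)
          have := hT.2
          show w ≤ ((G \ T) ∩ B (s.out T)).card
          omega
      · intro G hG G' hG' heq
        rw [Finset.mem_coe] at hG hG'
        have h1 := (hout G hG).1
        have h2 := (hout G' hG').1
        dsimp only at heq
        rw [← Finset.sdiff_union_of_subset h1, ← Finset.sdiff_union_of_subset h2, heq]
    calc _ ≤ _ := Nat.mul_le_mul_right _ hle
      _ ≤ _ := doubling _ _ _ _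
      _ ≤ _ := Nat.choose_le_choose _ hQ
  calc Bad.card * 2 ^ w
      ≤ (∑ t ∈ Finset.range (τ + 1), ∑ T ∈ (Finset.univ : Finset X).powersetCard t,
          (Bad.filter fun G => s.sel G = T).card) * 2 ^ w := by
        apply Nat.mul_le_mul_right
        refine (Finset.card_le_card h1).trans (Finset.card_biUnion_le.trans ?_)
        exact Finset.sum_le_sum fun t _ => Finset.card_biUnion_le
    _ = ∑ t ∈ Finset.range (τ + 1), ∑ T ∈ (Finset.univ : Finset X).powersetCard t,
          (Bad.filter fun G => s.sel G = T).card * 2 ^ w := by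
        rw [Finset.sum_mul]
        exact Finset.sum_congr rfl fun t _ => Finset.sum_mul _ _ _
    _ ≤ ∑ t ∈ Finset.range (τ + 1), ∑ T ∈ (Finset.univ : Finset X).powersetCard t,
          Q.choose (m - t) :=
        Finset.sum_le_sum fun t ht => Finset.sum_le_sum fun T hT => hfib t ht T hT
    _ = _ := by
        apply Finset.sum_congr rfl
        intro t _
        rw [Finset.sum_const, Finset.card_powersetCard, Finset.card_univ, smul_eq_mul]

theorem hfree_cp {α : Type} [Fintype α] (H : SimpleGraph α) {n : ℕ} (E : Finset (Sym2 (Fin n)))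
    (h : ¬ GraphCopy H (SimpleGraph.fromEdgeSet (E : Set (Sym2 (Fin n))))) :
    ∀ φ ∈ injs α n, ¬ cp H φ ⊆ E := by
  intro φ hφ hs
  rw [injs, Finset.mem_filter] at hφ
  apply h
  refine ⟨φ, hφ.2, fun a b hab => ?_⟩
  rw [SimpleGraph.fromEdgeSet_adj]
  exact ⟨(cp_subset_iff H E φ).1 hs a b hab, fun he => hab.ne (hφ.2 he)⟩

theorem dkp_of_mono {n : ℕ} (δ : ℝ) (r : ℕ) (E : Finset (Sym2 (Fin n)))
    (c : Fin n → ℕ) (hc : ∀ x, c x < r + 1)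
    (h : ((monoE E c).card : ℝ) ≤ δ * E.card) : DeltaKPartite n δ (r + 1) E := by
  refine ⟨monoE E c, Finset.filter_subset _ _, h, ?_⟩
  rw [SimpleGraph.colorable_iff_exists_bdd_nat_coloring]
  refine ⟨SimpleGraph.Coloring.mk c ?_, hc⟩
  intro x y hxy heq
  rw [SimpleGraph.fromEdgeSet_adj, Finset.mem_coe, Finset.mem_sdiff] at hxy
  apply hxy.1.2
  rw [monoE, Finset.mem_filter]
  refine ⟨hxy.1.1, ?_⟩
  simpa using heq

theorem tur_hfree {α : Type} (H : SimpleGraph α) (r : ℕ) (hH : ¬ H.Colorable (r + 1))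
    {n : ℕ} (E : Finset (Sym2 (Fin n))) (hE : E ⊆ turE n (r + 1)) :
    ¬ GraphCopy H (SimpleGraph.fromEdgeSet (E : Set (Sym2 (Fin n)))) := by
  rintro ⟨φ, hφ, h⟩
  apply hH
  rw [SimpleGraph.colorable_iff_exists_bdd_nat_coloring]
  refine ⟨SimpleGraph.Coloring.mk (fun a => (φ a : ℕ) % (r + 1)) ?_,
    fun a => Nat.mod_lt _ (Nat.succ_pos _)⟩
  intro a b hab
  have := h a b hab
  rw [SimpleGraph.fromEdgeSet_adj, Finset.mem_coe] at this
  have := hE this.1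
  rw [mem_turE] at this
  simpa using this

/-- the H-free graphs with `m` edges -/
noncomputable def HF {α : Type} (H : SimpleGraph α) (n m : ℕ) : Finset (Finset (Sym2 (Fin n))) :=
  ((ND n).powersetCard m).filter fun E =>
    ¬ GraphCopy H (SimpleGraph.fromEdgeSet (E : Set (Sym2 (Fin n))))

noncomputable def BadF {α : Type} (H : SimpleGraph α) (n m : ℕ) (δ : ℝ) (k : ℕ) :
    Finset (Finset (Sym2 (Fin n))) :=
  ((ND n).powersetCard m).filter fun E =>
    ¬ GraphCopy H (SimpleGraph.fromEdgeSet (E : Set (Sym2 (Fin n)))) ∧ ¬ DeltaKPartite n δ k E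

theorem HF_ge {α : Type} (H : SimpleGraph α) (r : ℕ) (hH : ¬ H.Colorable (r + 1)) (n m : ℕ) :
    (turE n (r + 1)).card.choose m ≤ (HF H n m).card := by
  rw [← Finset.card_powersetCard]
  apply Finset.card_le_card
  intro E hE
  rw [Finset.mem_powersetCard] at hE
  rw [HF, Finset.mem_filter, Finset.mem_powersetCard]
  exact ⟨⟨hE.1.trans (turE_sub _ _), hE.2⟩, tur_hfree H r hH E hE.1⟩

/-- the sparse case, counting part -/
theorem sparse_count {α : Type} [Fintype α] (H : SimpleGraph α) (r : ℕ)
    (hH : ¬ H.Colorable (r + 1)) (n m : ℕ) (hn : 1 ≤ n) (δ ε ε' θ κ ε₂ : ℝ) (hδ : 0 < δ) (hε : 0 < ε)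
    (hε' : 0 < ε') (hθ : 0 < θ) (hθ1 : θ ≤ 1) (hκ0 : 0 ≤ κ) (hκ : κ ≤ δ / 2) (hκ1 : κ ≤ 1)
    (hnε : 1 ≤ ε * n) (hnε' : 1 ≤ ε' * n)
    (hm : (m : ℝ) < (1 - 1 / ((r : ℝ) + 1)) * (n : ℝ) ^ 2 / 2 - ε * (n : ℝ) ^ 2)
    (hst : ∀ Γ : Finset (Sym2 (Fin n)), (∀ e ∈ Γ, ¬ e.IsDiag) →
      (((injs α n).filter fun φ => cp H φ ⊆ Γ).card : ℝ) ≤ ε₂ * (injs α n).card →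
      ∃ c : Fin n → ℕ, (∀ x, c x < r + 1) ∧
        2 * (Γ.card : ℝ) + 2 * (monoE Γ c).card ≤
          (1 - 1 / ((r : ℝ) + 1)) * (n : ℝ) ^ 2 + ε' * (n : ℝ) ^ 2)
    (s : Scheme (Sym2 (Fin n)) (Finset (Sym2 (Fin n))))
    (hs : ∀ I : Finset (Sym2 (Fin n)), (∀ φ ∈ injs α n, ¬ cp H φ ⊆ I) →
      ((s.sel I).card : ℝ) ≤ κ * m ∧ Disjoint (s.out I) I ∧
      (((injs α n).filter fun φ => Disjoint (cp H φ) (s.out I)).card : ℝ) ≤ ε₂ * (injs α n).card) :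
    ((BadF H n m δ (r + 1)).card : ℝ) * Real.exp (δ * m / 4) ≤
      (HF H n m).card * (Real.exp (2 * ε' * m / ε) * (Real.exp (κ * m * Real.log (θ⁻¹)) *
        Real.exp (θ * (2 * m / ε)))) := by
  have hn1 : (1 : ℝ) ≤ n := by exact_mod_cast hn
  set a : ℝ := (1 - 1 / ((r : ℝ) + 1)) * (n : ℝ) ^ 2 / 2 with ha
  set q := (turE n (r + 1)).card with hq
  set Q := max ⌊a + ε' * (n : ℝ) ^ 2 / 2⌋₊ q with hQ
  set τ := ⌊κ * m⌋₊ with hτ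
  set w := ⌈δ * m / 2⌉₊ with hw
  have hκm : 0 ≤ κ * m := by positivity
  have hτle : (τ : ℝ) ≤ κ * m := Nat.floor_le hκm
  have hτm : τ ≤ m := by
    have : (τ : ℝ) ≤ m := hτle.trans (by
      have : (0 : ℝ) ≤ m := by positivity
      nlinarith)
    exact_mod_cast this
  have hqge : a - n / 2 ≤ q := by
    have := card_turE n r
    rw [ha, hq]
    linarith
  have ha0 : 0 ≤ a := by
    rw [ha]
    have : 1 / ((r : ℝ) + 1) ≤ 1 := by
      rw [div_le_one (by positivity)]
      have : (0 : ℝ) ≤ r := by positivity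
      linarith
    have : 0 ≤ 1 - 1 / ((r : ℝ) + 1) := by linarith
    positivity
  have hqm : ε * (n : ℝ) ^ 2 / 2 ≤ (q : ℝ) - m := by nlinarith
  have hqm' : m < q := by
    have : (0 : ℝ) < (q : ℝ) - m := lt_of_lt_of_le (by positivity) hqm
    have : (m : ℝ) < q := by linarith
    exact_mod_cast this
  have hqQ : q ≤ Q := le_max_right _ _
  have hQq : (Q : ℝ) - q ≤ ε' * (n : ℝ) ^ 2 := by
    rcases max_choice ⌊a + ε' * (n : ℝ) ^ 2 / 2⌋₊ q with h | h
    · rw [hQ, h]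
      have := Nat.floor_le (a := a + ε' * (n : ℝ) ^ 2 / 2) (by positivity)
      nlinarith
    · rw [hQ, h, sub_self]; positivity
  -- union bound
  have hstep : ∀ o : Finset (Sym2 (Fin n)), ∃ c : Fin n → ℕ,
      (((injs α n).filter fun φ => Disjoint (cp H φ) o).card : ℝ) ≤ ε₂ * (injs α n).card →
      (∀ x, c x < r + 1) ∧ (ND n \ o).card + (monoE (ND n \ o) c).card ≤ Q := by
    intro o
    by_cases ho : (((injs α n).filter fun φ => Disjoint (cp H φ) o).card : ℝ) ≤
        ε₂ * (injs α n).card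
    · have hcard : (((injs α n).filter fun φ => cp H φ ⊆ ND n \ o).card : ℝ) ≤
          ((injs α n).filter fun φ => Disjoint (cp H φ) o).card := by
        apply Nat.cast_le.2
        apply Finset.card_le_card
        intro φ hφ
        rw [Finset.mem_filter] at hφ ⊢
        refine ⟨hφ.1, ?_⟩
        rw [Finset.disjoint_left]
        intro x hx hxo
        exact (Finset.mem_sdiff.1 (hφ.2 hx)).2 hxo
      obtain ⟨c, hc1, hc2⟩ := hst (ND n \ o) (fun e he => (mem_ND n e).1 (Finset.mem_sdiff.1 he).1)
        (hcard.trans ho)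
      refine ⟨c, fun _ => ⟨hc1, ?_⟩⟩
      refine le_trans ?_ (le_max_left _ _)
      apply Nat.le_floor
      push_cast
      rw [ha]
      linarith
    · exact ⟨fun _ => 0, fun h => absurd h ho⟩
  choose c hc using hstep
  have hub := union_bound m τ Q w s (fun o => ND n \ o) (fun o => monoE (ND n \ o) (c o))
    (BadF H n m δ (r + 1)) (by
      intro G hG
      rw [BadF, Finset.mem_filter, Finset.mem_powersetCard] at hG
      obtain ⟨⟨hG1, hG2⟩, hG3, hG4⟩ := hG
      obtain ⟨h1, h2, h3⟩ := hs G (hfree_cp H G hG3)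
      have hsub : G ⊆ ND n \ s.out G := by
        intro e he
        rw [Finset.mem_sdiff]
        exact ⟨hG1 he, fun h => Finset.disjoint_left.1 h2 h he⟩
      obtain ⟨c1, c2⟩ := hc (s.out G) h3
      refine ⟨hG2, Nat.le_floor h1, hsub, c2, ?_⟩
      have hmono : δ * m < ((monoE G (c (s.out G))).card : ℝ) := by
        by_contra hcon
        apply hG4
        apply dkp_of_mono δ r G _ c1
        rw [hG2]
        exact not_lt.1 hcon
      have hinter : monoE G (c (s.out G)) ⊆ G ∩ monoE (ND n \ s.out G) (c (s.out G)) := by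
        intro e he
        rw [monoE, Finset.mem_filter] at he
        rw [Finset.mem_inter, monoE, Finset.mem_filter]
        exact ⟨he.1, hsub he.1, he.2⟩
      refine le_trans ?_ ((Finset.card_le_card hinter).trans (le_of_eq (by congr!)))
      -- w + τ ≤ mono
      have hwlt : (w : ℝ) < δ * m / 2 + 1 := Nat.ceil_lt_add_one (by positivity)
      have : ((w + τ : ℕ) : ℝ) < ((monoE G (c (s.out G))).card : ℝ) + 1 := by
        push_cast
        have : κ * m ≤ δ / 2 * m := mul_le_mul_of_nonneg_right hκ (by positivity)
        linarith
      have : w + τ < (monoE G (c (s.out G))).card + 1 := by exact_mod_cast this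
      omega)
  have hub' : ((BadF H n m δ (r + 1)).card : ℝ) * 2 ^ w ≤ ∑ t ∈ Finset.range (τ + 1),
      (((Fintype.card (Sym2 (Fin n))).choose t : ℝ) * Q.choose (m - t)) := by
    exact_mod_cast hub
  have hQm : ε * (n : ℝ) ^ 2 / 2 ≤ (Q : ℝ) - m := by
    have : (q : ℝ) ≤ Q := by exact_mod_cast hqQ
    linarith
  have hQm0 : (0 : ℝ) < (Q : ℝ) - m := lt_of_lt_of_le (by positivity) hQm
  have hsc := sum_choose_bound (Fintype.card (Sym2 (Fin n))) Q m τ (hqm'.trans_le hqQ) hτm θ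
    (2 * m / ε) hθ hθ1 (by
      rw [div_le_div_iff₀ hQm0 hε]
      have h1 := (card_sym2_fin_le n hn).1
      have hm0 : (0 : ℝ) ≤ m := by positivity
      calc (Fintype.card (Sym2 (Fin n)) : ℝ) * m * ε ≤ (n : ℝ) ^ 2 * m * ε := by gcongr
        _ = 2 * m * (ε * (n : ℝ) ^ 2 / 2) := by ring
        _ ≤ _ := mul_le_mul_of_nonneg_left hQm (by positivity))
  have hcr := choose_ratio q m hqm' (Q - q)
  rw [Nat.add_sub_cancel' hqQ, Nat.cast_sub hqQ] at hcr
  have hcr2 : (Q.choose m : ℝ) ≤ (HF H n m).card * Real.exp (2 * ε' * m / ε) := by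
    refine hcr.trans ?_
    have h1 : (q.choose m : ℝ) ≤ (HF H n m).card := by exact_mod_cast HF_ge H r hH n m
    apply mul_le_mul h1 _ (Real.exp_pos _).le (by positivity)
    apply Real.exp_le_exp.2
    have hqm0 : (0 : ℝ) < (q : ℝ) - m := lt_of_lt_of_le (by positivity) hqm
    rw [← mul_div_assoc, div_le_div_iff₀ hqm0 hε]
    have hm0 : (0 : ℝ) ≤ m := by positivity
    calc ((Q : ℝ) - q) * m * ε ≤ (ε' * (n : ℝ) ^ 2) * m * ε := by gcongr
      _ = 2 * ε' * m * (ε * (n : ℝ) ^ 2 / 2) := by ring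
      _ ≤ _ := mul_le_mul_of_nonneg_left hqm (by positivity)
  have hth : (θ⁻¹) ^ τ ≤ Real.exp (κ * m * Real.log (θ⁻¹)) := by
    rw [← Real.exp_log (pow_pos (inv_pos.2 hθ) τ), Real.log_pow]
    apply Real.exp_le_exp.2
    apply mul_le_mul_of_nonneg_right hτle
    apply Real.log_nonneg
    exact (one_le_inv₀ hθ).2 hθ1
  have h2w : Real.exp (δ * m / 4) ≤ 2 ^ w := by
    rw [← Real.exp_log (pow_pos (two_pos (α := ℝ)) w), Real.log_pow]
    apply Real.exp_le_exp.2
    have hl : (1 / 2 : ℝ) ≤ Real.log 2 := by linarith [Real.log_two_gt_d9]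
    have hwge : δ * m / 2 ≤ (w : ℝ) := Nat.le_ceil _
    have : (w : ℝ) * (1 / 2) ≤ w * Real.log 2 := mul_le_mul_of_nonneg_left hl (by positivity)
    linarith
  calc ((BadF H n m δ (r + 1)).card : ℝ) * Real.exp (δ * m / 4)
      ≤ ((BadF H n m δ (r + 1)).card : ℝ) * 2 ^ w :=
        mul_le_mul_of_nonneg_left h2w (by positivity)
    _ ≤ _ := hub'
    _ ≤ _ := hsc
    _ ≤ ((HF H n m).card * Real.exp (2 * ε' * m / ε)) * (Real.exp (κ * m * Real.log (θ⁻¹)) *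
        Real.exp (θ * (2 * m / ε))) := by gcongr
    _ = _ := by ring

theorem not_two_facts {α : Type} [Fintype α] (H : SimpleGraph α) (h : ¬ H.Colorable 2) :
    2 ≤ Fintype.card α ∧ 1 ≤ H.edgeFinset.card := by
  constructor
  · by_contra hlt
    exact h (H.colorable_of_fintype.mono (by omega))
  · by_contra hlt
    have h0 : H.edgeFinset = ∅ := by
      rw [← Finset.card_eq_zero]; omega
    have h1 : H = ⊥ := by
      rw [← SimpleGraph.edgeFinset_eq_empty]
      exact h0
    apply h
    rw [h1, SimpleGraph.colorable_iff_exists_bdd_nat_coloring]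
    exact ⟨SimpleGraph.Coloring.mk (fun _ => 0) (fun hab => absurd hab (by simp)), fun _ => two_pos⟩

set_option maxHeartbeats 2000000 in
theorem main_core {α : Type} [Fintype α] (H : SimpleGraph α) (r : ℕ) (hr : 1 ≤ r)
    (hH1 : H.Colorable (r + 2)) (hH2 : ¬ H.Colorable (r + 1)) (δ : ℝ) (hδ : 0 < δ) :
    ∃ C : ℝ, 0 < C ∧ ∀ η : ℝ, 0 < η → ∃ n₀ : ℕ, ∀ n : ℕ, n₀ ≤ n → ∀ m : ℕ,
      C * (n : ℝ) ^ ((2 : ℝ) - 1 / m2 H) ≤ (m : ℝ) →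
      ((BadF H n m δ (r + 1)).card : ℝ) ≤ η * (HF H n m).card := by
  have hH3 : ¬ H.Colorable 2 := fun h => hH2 (h.mono (by omega))
  have hm2 := m2_ge_one H hH3
  obtain ⟨hv, hl⟩ := not_two_facts H hH3
  set ε : ℝ := min (1 / 8) (δ / 16) with hε
  have hε0 : 0 < ε := lt_min (by norm_num) (by positivity)
  have hε8 : ε ≤ 1 / 8 := min_le_left _ _
  have hεδ : ε ≤ δ / 16 := min_le_right _ _
  set ε' : ℝ := min (δ / 8) (ε * δ / 32) with hε'
  have hε'0 : 0 < ε' := lt_min (by positivity) (by positivity)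
  have hε'1 : ε' ≤ δ / 8 := min_le_left _ _
  have hε'2 : ε' ≤ ε * δ / 32 := min_le_right _ _
  set θ : ℝ := min 1 (ε * δ / 32) with hθ
  have hθ0 : 0 < θ := lt_min one_pos (by positivity)
  have hθ1 : θ ≤ 1 := min_le_left _ _
  have hθ2 : θ ≤ ε * δ / 32 := min_le_right _ _
  obtain ⟨ε₂, hε₂, n1, hst⟩ := struct H r hH1 ε' hε'0
  obtain ⟨K, hK, hU⟩ := HUnif_copies H hm2 hv hl
  obtain ⟨M, p0, hM, hp0, hcont⟩ := containers H.edgeFinset.card K hK (min ε₂ 1)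
    (lt_min hε₂ one_pos) (min_le_right _ _)
  set L := Real.log θ⁻¹ with hL
  have hL0 : 0 ≤ L := Real.log_nonneg ((one_le_inv₀ hθ0).2 hθ1)
  set C : ℝ := M * (1 + 2 / δ + 16 * L / δ) + 1 with hC
  have hC1 : 1 ≤ C := by
    have : 0 ≤ M * (1 + 2 / δ + 16 * L / δ) := by positivity
    linarith
  have hC0 : 0 < C := by linarith
  have hκ0 : 0 < M / C := by positivity
  have hκ1 : M / C ≤ 1 := by
    rw [div_le_one hC0, hC]
    have : 0 ≤ M * (2 / δ + 16 * L / δ) := by positivity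
    linarith
  have hκδ : M / C ≤ δ / 2 := by
    rw [div_le_iff₀ hC0, hC]
    have e : δ / 2 * (M * (1 + 2 / δ + 16 * L / δ) + 1) =
      M + (δ / 2 * M + 8 * M * L + δ / 2) := by field_simp; ring
    rw [e]
    have : 0 ≤ δ / 2 * M + 8 * M * L + δ / 2 := by positivity
    linarith
  have hκL : M / C * L ≤ δ / 16 := by
    rw [div_mul_eq_mul_div, div_le_iff₀ hC0, hC]
    have e : δ / 16 * (M * (1 + 2 / δ + 16 * L / δ) + 1) =
      M * L + (δ / 16 * M + M / 8 + δ / 16) := by field_simp; ring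
    rw [e]
    have : 0 ≤ δ / 16 * M + M / 8 + δ / 16 := by positivity
    linarith
  clear_value C ε ε' θ
  refine ⟨C, hC0, fun η hη => ?_⟩
  -- thresholds
  have hlim : Filter.Tendsto (fun n : ℕ => (n : ℝ) ^ (-(1 / m2 H))) Filter.atTop (nhds 0) :=
    (tendsto_rpow_neg_atTop (by positivity)).comp tendsto_natCast_atTop_atTop
  obtain ⟨n2, hn2⟩ := Filter.eventually_atTop.1 (hlim.eventually (ge_mem_nhds hp0))
  obtain ⟨n3, hn3⟩ := exists_nat_ge (1 / ε)
  obtain ⟨n4, hn4⟩ := exists_nat_ge (1 / ε')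
  obtain ⟨n5, hn5⟩ := exists_nat_ge (-Real.log η * 16 / δ)
  refine ⟨n1 + n2 + n3 + n4 + n5 + 2 * (Fintype.card α) ^ 2 + 2, ?_⟩
  intro n hn m hm
  have hn2' : 2 ≤ n := by omega
  have hn1' : 1 ≤ n := by omega
  have hnR : (2 : ℝ) ≤ n := by exact_mod_cast hn2'
  have hn3' : (n3 : ℝ) ≤ n := by
    have : n3 ≤ n := by omega
    exact_mod_cast this
  have hn4' : (n4 : ℝ) ≤ n := by
    have : n4 ≤ n := by omega
    exact_mod_cast this
  have hn5' : (n5 : ℝ) ≤ n := by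
    have : n5 ≤ n := by omega
    exact_mod_cast this
  have hstn := hst n (by omega)
  set p : ℝ := (n : ℝ) ^ (-(1 / m2 H)) with hp
  have hpp : 0 < p := by positivity
  have hnp : (n : ℝ) ^ 2 * p = (n : ℝ) ^ ((2 : ℝ) - 1 / m2 H) := by
    rw [hp, sub_eq_add_neg, Real.rpow_add (by linarith)]
    norm_num
  have hexp : (n : ℝ) ≤ (n : ℝ) ^ ((2 : ℝ) - 1 / m2 H) := by
    conv_lhs => rw [← Real.rpow_one (n : ℝ)]
    apply Real.rpow_le_rpow_of_exponent_le (by linarith)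
    have : 1 / m2 H ≤ 1 := by rw [div_le_one (by linarith)]; exact hm2
    linarith
  have hmn : (n : ℝ) ≤ m := by
    refine le_trans ?_ hm
    have h1 := mul_le_mul_of_nonneg_right hC1
      (show (0 : ℝ) ≤ (n : ℝ) ^ ((2 : ℝ) - 1 / m2 H) by linarith)
    linarith
  have hm0 : (0 : ℝ) ≤ m := by positivity
  by_cases hcase : (m : ℝ) < (1 - 1 / ((r : ℝ) + 1)) * (n : ℝ) ^ 2 / 2 - ε * (n : ℝ) ^ 2
  · -- sparse case
    obtain ⟨hN1, hN2⟩ := card_sym2_fin_le n hn1'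
    obtain ⟨s, hs⟩ := hcont (Sym2 (Fin n)) (α → Fin n) (injs α n) (cp H) p hpp
      (hn2 n (by omega)) (by
        have h1 := mul_le_mul_of_nonneg_left hN2 hpp.le
        linarith) (hU n (by omega))
    have hnε : 1 ≤ ε * n := by
      rw [div_le_iff₀ hε0] at hn3
      have := mul_le_mul_of_nonneg_right hn3' hε0.le
      linarith
    have hnε' : 1 ≤ ε' * n := by
      rw [div_le_iff₀ hε'0] at hn4
      have := mul_le_mul_of_nonneg_right hn4' hε'0.le
      linarith
    have hmain := sparse_count H r hH2 n m hn1' δ ε ε' θ (M / C) ε₂ hδ hε0 hε'0 hθ0 hθ1 hκ0.le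
      hκδ hκ1
      hnε hnε'
      hcase hstn s (by
        intro I hI
        obtain ⟨h1, h2, h3⟩ := hs I hI
        refine ⟨h1.trans ?_, h2, ?_⟩
        · have h4 : p * Fintype.card (Sym2 (Fin n)) ≤ (n : ℝ) ^ ((2 : ℝ) - 1 / m2 H) := by
            rw [← hnp, mul_comm]
            exact mul_le_mul_of_nonneg_right hN1 hpp.le
          have h5 : M * (n : ℝ) ^ ((2 : ℝ) - 1 / m2 H) = M / C * (C * (n : ℝ) ^ ((2 : ℝ) - 1 / m2 H)) := by
            field_simp
          calc _ ≤ M * (n : ℝ) ^ ((2 : ℝ) - 1 / m2 H) := mul_le_mul_of_nonneg_left h4 hM.le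
            _ = _ := h5
            _ ≤ _ := mul_le_mul_of_nonneg_left hm hκ0.le
        · have h6 : min ε₂ 1 * ((injs α n).card : ℝ) ≤ ε₂ * (injs α n).card :=
            mul_le_mul_of_nonneg_right (min_le_left _ _) (by positivity)
          refine le_trans (le_of_eq ?_) (h3.le.trans h6)
          congr!)
    rw [← Real.exp_add, ← Real.exp_add] at hmain
    have hb1 : 2 * ε' * m / ε ≤ δ / 16 * m := by
      rw [div_le_iff₀ hε0]
      have h1 := mul_le_mul_of_nonneg_right hε'2 hm0
      linarith
    have hb2 : M / C * m * L ≤ δ / 16 * m := by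
      have h1 := mul_le_mul_of_nonneg_right hκL hm0
      linarith
    have hb3 : θ * (2 * m / ε) ≤ δ / 16 * m := by
      rw [← mul_div_assoc, div_le_iff₀ hε0]
      have h1 := mul_le_mul_of_nonneg_right hθ2 hm0
      linarith
    have hη : Real.exp (2 * ε' * m / ε + (M / C * m * Real.log θ⁻¹ + θ * (2 * m / ε))) ≤
        η * Real.exp (δ * m / 4) := by
      conv_rhs => rw [← Real.exp_log hη]
      rw [← Real.exp_add]
      apply Real.exp_le_exp.2
      rw [div_le_iff₀ hδ] at hn5
      rw [← hL]
      have h1 := mul_le_mul_of_nonneg_right (hn5'.trans hmn) hδ.le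
      linarith
    have hfin : ((BadF H n m δ (r + 1)).card : ℝ) * Real.exp (δ * m / 4) ≤
        (η * (HF H n m).card) * Real.exp (δ * m / 4) := by
      refine hmain.trans ?_
      calc _ ≤ ((HF H n m).card : ℝ) * (η * Real.exp (δ * m / 4)) :=
            mul_le_mul_of_nonneg_left hη (by positivity)
        _ = _ := by ring
    exact le_of_mul_le_mul_right hfin (Real.exp_pos _)
  · -- dense case
    push Not at hcase
    have hempty : BadF H n m δ (r + 1) = ∅ := by
      rw [Finset.eq_empty_iff_forall_notMem]
      intro G hG
      rw [BadF, Finset.mem_filter, Finset.mem_powersetCard] at hG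
      obtain ⟨⟨hG1, hG2⟩, hG3, hG4⟩ := hG
      apply hG4
      have hcp := hfree_cp H G hG3
      obtain ⟨c, hc1, hc2⟩ := hstn G (fun e he => (mem_ND n e).1 (hG1 he)) (by
        have : ((injs α n).filter fun φ => cp H φ ⊆ G) = ∅ := by
          rw [Finset.filter_eq_empty_iff]
          intro φ hφ
          exact hcp φ hφ
        rw [this, Finset.card_empty]
        push_cast
        positivity)
      apply dkp_of_mono δ r G c hc1
      rw [hG2] at hc2 ⊢
      have hr' : 1 / ((r : ℝ) + 1) ≤ 1 / 2 := by
        have : (1 : ℝ) ≤ r := by exact_mod_cast hr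
        apply one_div_le_one_div_of_le <;> linarith
      have hnn : (0 : ℝ) ≤ (n : ℝ) ^ 2 := by positivity
      set X : ℝ := (1 - 1 / ((r : ℝ) + 1)) * (n : ℝ) ^ 2 with hX
      have hX1 : (n : ℝ) ^ 2 / 2 ≤ X := by
        rw [hX]; nlinarith
      have h1 : (n : ℝ) ^ 2 / 8 ≤ m := by nlinarith
      have h2 : ε * (n : ℝ) ^ 2 ≤ δ / 16 * (n : ℝ) ^ 2 := mul_le_mul_of_nonneg_right hεδ hnn
      have h3 : ε' * (n : ℝ) ^ 2 ≤ δ / 8 * (n : ℝ) ^ 2 := mul_le_mul_of_nonneg_right hε'1 hnn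
      have h4 : δ * ((n : ℝ) ^ 2 / 8) ≤ δ * m := mul_le_mul_of_nonneg_left h1 hδ.le
      linarith
    rw [hempty, Finset.card_empty]
    push_cast
    positivity

/-- Theorem 1.6: almost all `H`-free graphs with `n` vertices and `m` edges are
`(δ, χ(H) - 1)`-partite. -/
theorem typical_structure_Hfree {α : Type} [Fintype α] [DecidableEq α]
    (H : SimpleGraph α) [DecidableRel H.Adj]
    (χ : ℕ) (hχ : H.chromaticNumber = (χ : ℕ∞)) (hχ3 : 3 ≤ χ)
    (δ : ℝ) (hδ : 0 < δ) :
    ∃ C : ℝ, 0 < C ∧ ∀ η : ℝ, 0 < η → ∃ n₀ : ℕ, ∀ n : ℕ, n₀ ≤ n → ∀ m : ℕ,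
      C * (n : ℝ) ^ ((2 : ℝ) - 1 / m2 H) ≤ (m : ℝ) → m ≤ n.choose 2 →
      ((((Finset.univ.filter fun e : Sym2 (Fin n) => ¬ e.IsDiag).powersetCard m).filter
          (fun E : Finset (Sym2 (Fin n)) =>
            ¬ GraphCopy H (SimpleGraph.fromEdgeSet (E : Set (Sym2 (Fin n)))) ∧
            ¬ DeltaKPartite n δ (χ - 1) E)).card : ℝ)
        ≤ η * ((((Finset.univ.filter fun e : Sym2 (Fin n) => ¬ e.IsDiag).powersetCard m).filter
            (fun E : Finset (Sym2 (Fin n)) =>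
              ¬ GraphCopy H (SimpleGraph.fromEdgeSet (E : Set (Sym2 (Fin n)))))).card : ℝ) := by
  obtain ⟨r, rfl⟩ : ∃ r, χ = r + 2 := ⟨χ - 2, by omega⟩
  have hH1 : H.Colorable (r + 2) := SimpleGraph.chromaticNumber_le_iff_colorable.1 hχ.le
  have hH2 : ¬ H.Colorable (r + 1) := by
    intro h
    have h1 := SimpleGraph.chromaticNumber_le_iff_colorable.2 h
    rw [hχ] at h1
    have h2 : r + 2 ≤ r + 1 := by exact_mod_cast h1
    omega
  obtain ⟨C, hC, hmain⟩ := main_core H r (by omega) hH1 hH2 δ hδ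
  refine ⟨C, hC, fun η hη => ?_⟩
  obtain ⟨n₀, hn₀⟩ := hmain η hη
  refine ⟨n₀, fun n hn m hm _ => ?_⟩
  have key := hn₀ n hn m hm
  unfold BadF HF ND at key
  rw [show r + 2 - 1 = r + 1 by omega]
  convert key
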